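/- arXiv:1805.02554 — 3 statements merged into one kernel-verified Lean document; each statement's English description precedes it below -/
import Mathlib

section
/- Let κ and λ be cardinals with 3 ≤ κ and 3 ≤ λ. Let F be a lattice freely generated by a family x : ι → F with #ι = λ, and let G be a lattice freely generated by a family y : ρ → G with #ρ = κ. Then there exists a totally symmetric embedding of G into F if and only if λ < ℵ₀ and (κ = ℵ₀ or κ = 2·k for some positive natural number k). -/
open Cardinal

universe u

/-- A lattice `F` is freely generated by the family `x : ι → F` if the sublattice generated by
the range of `x` is all of `F` and every map from the generators into a lattice extends to a
lattice homomorphism. -/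
def IsFreelyGenerated {F : Type*} [Lattice F] {ι : Type*} (x : ι → F) : Prop :=
  latticeClosure (Set.range x) = Set.univ ∧
    ∀ (K : Type*) [Lattice K] (f : ι → K), ∃ φ : LatticeHom F K, ∀ i, φ (x i) = f i

/-- An element `u` of a lattice is symmetric if it is fixed by every automorphism. -/
def IsSymmElem {F : Type*} [Lattice F] (u : F) : Prop := ∀ π : F ≃o F, π u = u

/-- The image of `t` under a dual automorphism `δ : F ≃o Fᵒᵈ`, viewed back in `F`. -/
def dBar {F : Type*} [Lattice F] (δ : F ≃o Fᵒᵈ) (t : F) : F := OrderDual.ofDual (δ t)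

/-- A subset `S` of `F` is selfdually positioned (w.r.t. the dual automorphism `δ`)
if `δ '' S = S`. -/
def SelfduallyPositioned {F : Type*} [Lattice F] (δ : F ≃o Fᵒᵈ) (S : Set F) : Prop :=
  dBar δ '' S = S

/-- A totally symmetric embedding of `G` into `F` (with natural dual automorphism `δ`):
an injective lattice homomorphism whose range is selfdually positioned and consists of
symmetric elements. -/
def IsTotallySymmetricEmbedding {G F : Type*} [Lattice G] [Lattice F]
    (δ : F ≃o Fᵒᵈ) (φ : LatticeHom G F) : Prop :=
  Function.Injective φ ∧ SelfduallyPositioned δ (Set.range ⇑φ) ∧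
    ∀ u ∈ Set.range ⇑φ, IsSymmElem u

namespace TSE

/-! ### Lattice terms and the Whitman order -/

/-- Lattice terms. -/
inductive Tm (α : Type*) where
  | var : α → Tm α
  | sup : Tm α → Tm α → Tm α
  | inf : Tm α → Tm α → Tm α

namespace Tm

/-- Evaluation of a term in a lattice. -/
def eval {α K : Type*} [Lattice K] (f : α → K) : Tm α → K
  | var a => f a
  | sup s t => eval f s ⊔ eval f t
  | inf s t => eval f s ⊓ eval f t

/-- Renaming of variables. -/
def map {α β : Type*} (f : α → β) : Tm α → Tm β
  | var a => var (f a)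
  | sup s t => sup (map f s) (map f t)
  | inf s t => inf (map f s) (map f t)

/-- The dual term. -/
def dual {α : Type*} : Tm α → Tm α
  | var a => var a
  | sup s t => inf (dual s) (dual t)
  | inf s t => sup (dual s) (dual t)

/-- The variables of a term. -/
def vars {α : Type*} : Tm α → Set α
  | var a => {a}
  | sup s t => vars s ∪ vars t
  | inf s t => vars s ∪ vars t

theorem vars_finite {α : Type*} (t : Tm α) : t.vars.Finite := by
  induction t with
  | var a => exact Set.finite_singleton a
  | sup s t hs ht => exact hs.union ht
  | inf s t hs ht => exact hs.union ht

theorem eval_map {α β K : Type*} [Lattice K] (f : β → K) (g : α → β) (t : Tm α) :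
    eval f (map g t) = eval (f ∘ g) t := by
  induction t <;> simp_all [eval, map]

theorem map_map_eq {α β : Type*} (f : α → β) (g : β → α) (t : Tm α)
    (h : ∀ a ∈ t.vars, g (f a) = a) : map g (map f t) = t := by
  induction t with
  | var a => simp [map, h a rfl]
  | sup s t hs ht =>
    simp only [map]
    rw [hs fun a ha => h a (Or.inl ha), ht fun a ha => h a (Or.inr ha)]
  | inf s t hs ht =>
    simp only [map]
    rw [hs fun a ha => h a (Or.inl ha), ht fun a ha => h a (Or.inr ha)]

theorem map_eval {α K L : Type*} [Lattice K] [Lattice L] (φ : K → L)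
    (hs : ∀ a b, φ (a ⊔ b) = φ a ⊔ φ b) (hi : ∀ a b, φ (a ⊓ b) = φ a ⊓ φ b)
    (f : α → K) (t : Tm α) : φ (eval f t) = eval (fun a => φ (f a)) t := by
  induction t <;> simp_all [eval]

theorem anti_eval {α K L : Type*} [Lattice K] [Lattice L] (φ : K → L)
    (hs : ∀ a b, φ (a ⊔ b) = φ a ⊓ φ b) (hi : ∀ a b, φ (a ⊓ b) = φ a ⊔ φ b)
    (f : α → K) (t : Tm α) : φ (eval f t) = eval (fun a => φ (f a)) (dual t) := by
  induction t <;> simp_all [eval, dual]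

theorem eval_le {α K : Type*} [Lattice K] (f : α → K) (m : K) (t : Tm α)
    (h : ∀ a, f a ≤ m) : eval f t ≤ m := by
  induction t with
  | var a => exact h a
  | sup s t hs ht => exact sup_le hs ht
  | inf s t hs ht => exact inf_le_of_left_le hs

/-- the Whitman order on terms. -/
inductive Le {α : Type*} : Tm α → Tm α → Prop
  | var (a : α) : Le (var a) (var a)
  | supL {s t r : Tm α} : Le s r → Le t r → Le (sup s t) r
  | infR {s t r : Tm α} : Le r s → Le r t → Le r (inf s t)
  | infL1 {s t r : Tm α} : Le s r → Le (inf s t) r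
  | infL2 {s t r : Tm α} : Le t r → Le (inf s t) r
  | supR1 {s t r : Tm α} : Le r s → Le r (sup s t)
  | supR2 {s t r : Tm α} : Le r t → Le r (sup s t)

namespace Le

theorem rfl' {α : Type*} (t : Tm α) : Le t t := by
  induction t with
  | var a => exact Le.var a
  | sup s t hs ht => exact supL (supR1 hs) (supR2 ht)
  | inf s t hs ht => exact infR (infL1 hs) (infL2 ht)

theorem sup_inv {α : Type*} {s t r : Tm α} (h : Le (Tm.sup s t) r) : Le s r ∧ Le t r := by
  generalize hu : Tm.sup s t = u at h
  induction h with
  | var a => cases hu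
  | supL h1 h2 _ _ => cases hu; exact ⟨h1, h2⟩
  | infR _ _ i1 i2 => exact ⟨infR (i1 hu).1 (i2 hu).1, infR (i1 hu).2 (i2 hu).2⟩
  | infL1 _ _ => cases hu
  | infL2 _ _ => cases hu
  | supR1 _ i => exact ⟨supR1 (i hu).1, supR1 (i hu).2⟩
  | supR2 _ i => exact ⟨supR2 (i hu).1, supR2 (i hu).2⟩

theorem inf_inv {α : Type*} {s t r : Tm α} (h : Le r (Tm.inf s t)) : Le r s ∧ Le r t := by
  generalize hu : Tm.inf s t = u at h
  induction h with
  | var a => cases hu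
  | infR h1 h2 _ _ => cases hu; exact ⟨h1, h2⟩
  | supL _ _ i1 i2 => exact ⟨supL (i1 hu).1 (i2 hu).1, supL (i1 hu).2 (i2 hu).2⟩
  | supR1 _ _ => cases hu
  | supR2 _ _ => cases hu
  | infL1 _ i => exact ⟨infL1 (i hu).1, infL1 (i hu).2⟩
  | infL2 _ i => exact ⟨infL2 (i hu).1, infL2 (i hu).2⟩

theorem trans' {α : Type*} {t : Tm α} : ∀ {s r : Tm α}, Le s t → Le t r → Le s r := by
  induction t with
  | var a =>
    intro s r h1 h2
    generalize hu : Tm.var a = u at h1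
    induction h1 with
    | var b => cases hu; exact h2
    | supL _ _ i1 i2 => exact supL (i1 hu) (i2 hu)
    | infR _ _ _ _ => cases hu
    | infL1 _ i => exact infL1 (i hu)
    | infL2 _ i => exact infL2 (i hu)
    | supR1 _ _ => cases hu
    | supR2 _ _ => cases hu
  | sup t1 t2 ih1 ih2 =>
    intro s r h1 h2
    generalize hu : Tm.sup t1 t2 = u at h1
    induction h1 with
    | var b => cases hu
    | supL _ _ i1 i2 => exact supL (i1 hu) (i2 hu)
    | infR _ _ _ _ => cases hu
    | infL1 _ i => exact infL1 (i hu)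
    | infL2 _ i => exact infL2 (i hu)
    | supR1 h _ => cases hu; exact ih1 h (sup_inv h2).1
    | supR2 h _ => cases hu; exact ih2 h (sup_inv h2).2
  | inf t1 t2 ih1 ih2 =>
    intro s r h1 h2
    generalize hu : Tm.inf t1 t2 = u at h2
    induction h2 with
    | var b => cases hu
    | supL _ _ _ _ => cases hu
    | infR _ _ i1 i2 => exact infR (i1 hu) (i2 hu)
    | infL1 h _ => cases hu; exact ih1 (inf_inv h1).1 h
    | infL2 h _ => cases hu; exact ih2 (inf_inv h1).2 h
    | supR1 _ i => exact supR1 (i hu)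
    | supR2 _ i => exact supR2 (i hu)

theorem sound {α K : Type*} [Lattice K] (f : α → K) {s t : Tm α} (h : Le s t) :
    eval f s ≤ eval f t := by
  induction h with
  | var a => exact le_rfl
  | supL _ _ i1 i2 => exact sup_le i1 i2
  | infR _ _ i1 i2 => exact le_inf i1 i2
  | infL1 _ i => exact inf_le_of_left_le i
  | infL2 _ i => exact inf_le_of_right_le i
  | supR1 _ i => exact le_sup_of_le_left i
  | supR2 _ i => exact le_sup_of_le_right i

theorem map_le {α β : Type*} (f : α → β) {s t : Tm α} (h : Le s t) :
    Le (map f s) (map f t) := by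
  induction h with
  | var a => exact Le.var _
  | supL _ _ i1 i2 => exact supL i1 i2
  | infR _ _ i1 i2 => exact infR i1 i2
  | infL1 _ i => exact infL1 i
  | infL2 _ i => exact infL2 i
  | supR1 _ i => exact supR1 i
  | supR2 _ i => exact supR2 i

theorem sup_iff {α : Type*} {s t r : Tm α} : Le (Tm.sup s t) r ↔ Le s r ∧ Le t r :=
  ⟨sup_inv, fun h => supL h.1 h.2⟩

theorem inf_iff {α : Type*} {s t r : Tm α} : Le r (Tm.inf s t) ↔ Le r s ∧ Le r t :=
  ⟨inf_inv, fun h => infR h.1 h.2⟩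

theorem var_var_iff {α : Type*} {a b : α} : Le (Tm.var a) (Tm.var b) ↔ a = b := by
  constructor
  · intro h; cases h; rfl
  · rintro rfl; exact Le.var a

theorem var_sup_iff {α : Type*} {a : α} {s t : Tm α} :
    Le (Tm.var a) (Tm.sup s t) ↔ Le (Tm.var a) s ∨ Le (Tm.var a) t := by
  constructor
  · intro h
    cases h with
    | supR1 h => exact Or.inl h
    | supR2 h => exact Or.inr h
  · rintro (h | h)
    · exact supR1 h
    · exact supR2 h

theorem inf_var_iff {α : Type*} {a : α} {s t : Tm α} :
    Le (Tm.inf s t) (Tm.var a) ↔ Le s (Tm.var a) ∨ Le t (Tm.var a) := by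
  constructor
  · intro h
    cases h with
    | infL1 h => exact Or.inl h
    | infL2 h => exact Or.inr h
  · rintro (h | h)
    · exact infL1 h
    · exact infL2 h

theorem inf_sup_iff {α : Type*} {a b c d : Tm α} :
    Le (Tm.inf a b) (Tm.sup c d) ↔
      Le a (Tm.sup c d) ∨ Le b (Tm.sup c d) ∨ Le (Tm.inf a b) c ∨ Le (Tm.inf a b) d := by
  constructor
  · intro h
    cases h with
    | infL1 h => exact Or.inl h
    | infL2 h => exact Or.inr (Or.inl h)
    | supR1 h => exact Or.inr (Or.inr (Or.inl h))
    | supR2 h => exact Or.inr (Or.inr (Or.inr h))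
  · rintro (h | h | h | h)
    · exact infL1 h
    · exact infL2 h
    · exact supR1 h
    · exact supR2 h

end Le

instance instPreorderTm {α : Type*} : Preorder (Tm α) where
  le := Le
  le_refl := Le.rfl'
  le_trans _ _ _ := Le.trans'

theorem le_def {α : Type*} {s t : Tm α} : s ≤ t ↔ Le s t := Iff.rfl

end Tm

/-- The free lattice on `α`. -/
def FL (α : Type*) := Antisymmetrization (Tm α) (· ≤ ·)

namespace FL

instance instPartialOrderFL {α : Type*} : PartialOrder (FL α) :=
  inferInstanceAs (PartialOrder (Antisymmetrization (Tm α) (· ≤ ·)))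

/-- The class of a term. -/
def mk {α : Type*} (t : Tm α) : FL α := toAntisymmetrization (· ≤ ·) t

theorem mk_le {α : Type*} {s t : Tm α} : mk s ≤ mk t ↔ Tm.Le s t := Iff.rfl

theorem mk_surj {α : Type*} (u : FL α) : ∃ t, mk t = u := by
  induction u using Quotient.inductionOn with
  | h t => exact ⟨t, rfl⟩

noncomputable instance instLatticeFL {α : Type*} : Lattice (FL α) where
  sup u v := mk (Tm.sup (mk_surj u).choose (mk_surj v).choose)
  inf u v := mk (Tm.inf (mk_surj u).choose (mk_surj v).choose)
  le_sup_left u v := by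
    conv_lhs => rw [← (mk_surj u).choose_spec]
    exact mk_le.2 (Tm.Le.supR1 (Tm.Le.rfl' _))
  le_sup_right u v := by
    conv_lhs => rw [← (mk_surj v).choose_spec]
    exact mk_le.2 (Tm.Le.supR2 (Tm.Le.rfl' _))
  sup_le u v w h1 h2 := by
    rw [← (mk_surj u).choose_spec, ← (mk_surj w).choose_spec] at h1
    rw [← (mk_surj v).choose_spec, ← (mk_surj w).choose_spec] at h2
    conv_rhs => rw [← (mk_surj w).choose_spec]
    exact mk_le.2 (Tm.Le.supL h1 h2)
  inf_le_left u v := by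
    conv_rhs => rw [← (mk_surj u).choose_spec]
    exact mk_le.2 (Tm.Le.infL1 (Tm.Le.rfl' _))
  inf_le_right u v := by
    conv_rhs => rw [← (mk_surj v).choose_spec]
    exact mk_le.2 (Tm.Le.infL2 (Tm.Le.rfl' _))
  le_inf u v w h1 h2 := by
    rw [← (mk_surj u).choose_spec, ← (mk_surj v).choose_spec] at h1
    rw [← (mk_surj u).choose_spec, ← (mk_surj w).choose_spec] at h2
    conv_lhs => rw [← (mk_surj u).choose_spec]
    exact mk_le.2 (Tm.Le.infR h1 h2)

theorem mk_sup {α : Type*} (s t : Tm α) : mk (Tm.sup s t) = mk s ⊔ mk t := by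
  apply le_antisymm
  · have h1 : mk s ≤ mk s ⊔ mk t := le_sup_left
    have h2 : mk t ≤ mk s ⊔ mk t := le_sup_right
    obtain ⟨r, hr⟩ := mk_surj (mk s ⊔ mk t)
    rw [← hr] at h1 h2 ⊢
    exact mk_le.2 (Tm.Le.supL h1 h2)
  · exact sup_le (mk_le.2 (Tm.Le.supR1 (Tm.Le.rfl' _))) (mk_le.2 (Tm.Le.supR2 (Tm.Le.rfl' _)))

theorem mk_inf {α : Type*} (s t : Tm α) : mk (Tm.inf s t) = mk s ⊓ mk t := by
  apply le_antisymm
  · exact le_inf (mk_le.2 (Tm.Le.infL1 (Tm.Le.rfl' _))) (mk_le.2 (Tm.Le.infL2 (Tm.Le.rfl' _)))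
  · have h1 : mk s ⊓ mk t ≤ mk s := inf_le_left
    have h2 : mk s ⊓ mk t ≤ mk t := inf_le_right
    obtain ⟨r, hr⟩ := mk_surj (mk s ⊓ mk t)
    rw [← hr] at h1 h2 ⊢
    exact mk_le.2 (Tm.Le.infR h1 h2)

/-- The generators. -/
def of {α : Type*} (a : α) : FL α := mk (Tm.var a)

theorem eval_of {α : Type*} (t : Tm α) : Tm.eval of t = mk t := by
  induction t <;> simp_all [Tm.eval, mk_sup, mk_inf, of]

end FL

/-- `x` generates `F`, and the order of `F` is the Whitman order. -/
structure FreeRep {α F : Type*} [Lattice F] (x : α → F) : Prop where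
  surj : ∀ u : F, ∃ t : Tm α, Tm.eval x t = u
  le_iff : ∀ s t : Tm α, Tm.eval x s ≤ Tm.eval x t ↔ Tm.Le s t

theorem FL.freeRep (α : Type*) : FreeRep (FL.of : α → FL α) where
  surj u := by
    obtain ⟨t, rfl⟩ := FL.mk_surj u
    exact ⟨t, FL.eval_of t⟩
  le_iff s t := by rw [FL.eval_of, FL.eval_of, FL.mk_le]

theorem freeRep_of_free {α F : Type*} [Lattice F] {x : α → F} (hx : IsFreelyGenerated x) :
    FreeRep x where
  surj u := by
    have hu : u ∈ latticeClosure (Set.range x) := by rw [hx.1]; trivial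
    let S : Set F := {u | ∃ t : Tm α, Tm.eval x t = u}
    have hS : IsSublattice S := by
      constructor
      · rintro _ ⟨s, rfl⟩ _ ⟨t, rfl⟩; exact ⟨Tm.sup s t, rfl⟩
      · rintro _ ⟨s, rfl⟩ _ ⟨t, rfl⟩; exact ⟨Tm.inf s t, rfl⟩
    have : latticeClosure (Set.range x) ⊆ S :=
      latticeClosure_min (by rintro _ ⟨a, rfl⟩; exact ⟨Tm.var a, rfl⟩) hS
    exact this hu
  le_iff s t := by
    classical
    refine ⟨fun h => ?_, fun h => h.sound x⟩
    have hfin : (s.vars ∪ t.vars).Finite := s.vars_finite.union t.vars_finite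
    have hc : Countable (s.vars ∪ t.vars : Set α) := hfin.countable.to_subtype
    obtain ⟨e, he⟩ := hc
    have : Nonempty α := by
      cases s with
      | var a => exact ⟨a⟩
      | sup s _ => exact ⟨(Tm.rec (motive := fun _ => α) (fun a => a) (fun _ _ a _ => a)
          (fun _ _ a _ => a) s)⟩
      | inf s _ => exact ⟨(Tm.rec (motive := fun _ => α) (fun a => a) (fun _ _ a _ => a)
          (fun _ _ a _ => a) s)⟩
    let f : α → ULift ℕ := fun a => if ha : a ∈ s.vars ∪ t.vars then ⟨e ⟨a, ha⟩⟩ else ⟨0⟩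
    have hf : Set.InjOn f (s.vars ∪ t.vars) := by
      intro a ha b hb hab
      simp only [f, dif_pos ha, dif_pos hb, ULift.up.injEq] at hab
      exact congrArg Subtype.val (he hab)
    let g : ULift ℕ → α := Function.invFunOn f (s.vars ∪ t.vars)
    have hg : ∀ a ∈ s.vars ∪ t.vars, g (f a) = a := fun a ha => hf.leftInvOn_invFunOn ha
    obtain ⟨φ, hφ⟩ := hx.2 (FL (ULift ℕ)) (fun a => FL.of (f a))
    have h2 := OrderHomClass.mono φ h
    rw [Tm.map_eval φ (map_sup φ) (map_inf φ), Tm.map_eval φ (map_sup φ) (map_inf φ)] at h2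
    simp only [hφ] at h2
    have h3 : Tm.eval FL.of (Tm.map f s) ≤ Tm.eval FL.of (Tm.map f t) := by
      rw [Tm.eval_map, Tm.eval_map]; exact h2
    rw [(FL.freeRep _).le_iff] at h3
    have h4 := h3.map_le g
    rwa [Tm.map_map_eq f g s fun a ha => hg a (Or.inl ha),
      Tm.map_map_eq f g t fun a ha => hg a (Or.inr ha)] at h4

/-! ### Consequences of the Whitman order -/

/-- the Whitman condition. -/
def Whit (F : Type*) [Lattice F] : Prop :=
  ∀ a b c d : F, a ⊓ b ≤ c ⊔ d → a ≤ c ⊔ d ∨ b ≤ c ⊔ d ∨ a ⊓ b ≤ c ∨ a ⊓ b ≤ d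

namespace FreeRep

variable {α F : Type*} [Lattice F] {x : α → F}

theorem whit (h : FreeRep x) : Whit F := by
  intro a b c d
  obtain ⟨a, rfl⟩ := h.surj a
  obtain ⟨b, rfl⟩ := h.surj b
  obtain ⟨c, rfl⟩ := h.surj c
  obtain ⟨d, rfl⟩ := h.surj d
  change Tm.eval x (a.inf b) ≤ Tm.eval x (c.sup d) → Tm.eval x a ≤ Tm.eval x (c.sup d) ∨
    Tm.eval x b ≤ Tm.eval x (c.sup d) ∨ Tm.eval x (a.inf b) ≤ Tm.eval x c ∨
      Tm.eval x (a.inf b) ≤ Tm.eval x d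
  simp only [h.le_iff]
  exact Tm.Le.inf_sup_iff.1

theorem sup_prime (h : FreeRep x) (i : α) (c d : F) : x i ≤ c ⊔ d ↔ x i ≤ c ∨ x i ≤ d := by
  obtain ⟨c, rfl⟩ := h.surj c
  obtain ⟨d, rfl⟩ := h.surj d
  change Tm.eval x (Tm.var i) ≤ Tm.eval x (c.sup d) ↔ Tm.eval x (Tm.var i) ≤ Tm.eval x c ∨
    Tm.eval x (Tm.var i) ≤ Tm.eval x d
  simp only [h.le_iff]
  exact Tm.Le.var_sup_iff

theorem inf_prime (h : FreeRep x) (i : α) (c d : F) : c ⊓ d ≤ x i ↔ c ≤ x i ∨ d ≤ x i := by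
  obtain ⟨c, rfl⟩ := h.surj c
  obtain ⟨d, rfl⟩ := h.surj d
  change Tm.eval x (c.inf d) ≤ Tm.eval x (Tm.var i) ↔ Tm.eval x c ≤ Tm.eval x (Tm.var i) ∨
    Tm.eval x d ≤ Tm.eval x (Tm.var i)
  simp only [h.le_iff]
  exact Tm.Le.inf_var_iff

theorem var_le (h : FreeRep x) (i j : α) : x i ≤ x j ↔ i = j := by
  change Tm.eval x (Tm.var i) ≤ Tm.eval x (Tm.var j) ↔ _
  rw [h.le_iff, Tm.Le.var_var_iff]

theorem inj (h : FreeRep x) : Function.Injective x := fun i j hij =>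
  (h.var_le i j).1 hij.le

theorem eval_eq (h : FreeRep x) {K : Type*} [Lattice K] (f : α → K) {s t : Tm α}
    (hst : Tm.eval x s = Tm.eval x t) : Tm.eval f s = Tm.eval f t :=
  le_antisymm (((h.le_iff s t).1 hst.le).sound f) (((h.le_iff t s).1 hst.ge).sound f)

theorem exists_lift (h : FreeRep x) {K : Type*} [Lattice K] (f : α → K) :
    ∃ φ : LatticeHom F K, ∀ t, φ (Tm.eval x t) = Tm.eval f t := by
  choose r hr using h.surj
  have key : ∀ t, Tm.eval f (r (Tm.eval x t)) = Tm.eval f t := fun t => h.eval_eq f (hr _)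
  refine ⟨{ toFun := fun u => Tm.eval f (r u), map_sup' := ?_, map_inf' := ?_ }, key⟩
  · intro a b
    have := key ((r a).sup (r b))
    simpa only [Tm.eval, hr] using this
  · intro a b
    have := key ((r a).inf (r b))
    simpa only [Tm.eval, hr] using this

/-- doubly irreducible elements are generators -/
theorem mem_range (h : FreeRep x) {u : F} (hs : ∀ a b, u = a ⊔ b → u = a ∨ u = b)
    (hi : ∀ a b, u = a ⊓ b → u = a ∨ u = b) : ∃ i, u = x i := by
  obtain ⟨t, ht⟩ := h.surj u
  induction t with
  | var i => exact ⟨i, ht.symm⟩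
  | sup s t h1 h2 => rcases hs _ _ ht.symm with h | h
                     · exact h1 h.symm
                     · exact h2 h.symm
  | inf s t h1 h2 => rcases hi _ _ ht.symm with h | h
                     · exact h1 h.symm
                     · exact h2 h.symm

theorem sup_irred (h : FreeRep x) (i : α) (a b : F) (hab : x i = a ⊔ b) : x i = a ∨ x i = b := by
  rcases (h.sup_prime i a b).1 hab.le with h | h
  · exact Or.inl (le_antisymm h (hab ▸ le_sup_left))
  · exact Or.inr (le_antisymm h (hab ▸ le_sup_right))

theorem inf_irred (h : FreeRep x) (i : α) (a b : F) (hab : x i = a ⊓ b) : x i = a ∨ x i = b := by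
  rcases (h.inf_prime i a b).1 hab.ge with h | h
  · exact Or.inl (le_antisymm (hab ▸ inf_le_left) h)
  · exact Or.inr (le_antisymm (hab ▸ inf_le_right) h)

/-- automorphisms permute generators -/
theorem exists_perm (h : FreeRep x) (π : F ≃o F) : ∃ σ : Equiv.Perm α, ∀ i, π (x i) = x (σ i) := by
  have key : ∀ (π : F ≃o F) (i : α), ∃ j, π (x i) = x j := by
    intro π i
    apply h.mem_range
    · intro a b hab
      have : x i = π.symm a ⊔ π.symm b := by rw [← map_sup, ← hab]; simp
      rcases h.sup_irred i _ _ this with h | h <;> simp [h]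
    · intro a b hab
      have : x i = π.symm a ⊓ π.symm b := by rw [← map_inf, ← hab]; simp
      rcases h.inf_irred i _ _ this with h | h <;> simp [h]
  choose σ hσ using key π
  choose τ hτ using key π.symm
  refine ⟨⟨σ, τ, fun i => h.inj ?_, fun i => h.inj ?_⟩, hσ⟩
  · rw [← hτ, ← hσ]; simp
  · rw [← hσ, ← hτ]; simp

/-- permutations induce automorphisms -/
theorem exists_auto (h : FreeRep x) (σ : Equiv.Perm α) : ∃ π : F ≃o F, ∀ i, π (x i) = x (σ i) := by
  obtain ⟨φ, hφ⟩ := h.exists_lift (x ∘ σ)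
  obtain ⟨ψ, hψ⟩ := h.exists_lift (x ∘ σ.symm)
  have e1 : ∀ u, ψ (φ u) = u := by
    intro u
    obtain ⟨t, rfl⟩ := h.surj u
    rw [hφ, Tm.map_eval ψ (map_sup ψ) (map_inf ψ)]
    congr 1
    funext i
    have := hψ (Tm.var (σ i))
    simpa [Tm.eval] using this
  have e2 : ∀ u, φ (ψ u) = u := by
    intro u
    obtain ⟨t, rfl⟩ := h.surj u
    rw [hψ, Tm.map_eval φ (map_sup φ) (map_inf φ)]
    congr 1
    funext i
    have := hφ (Tm.var (σ.symm i))
    simpa [Tm.eval] using this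
  refine ⟨{ toFun := φ, invFun := ψ, left_inv := e1, right_inv := e2, map_rel_iff' := ?_ }, ?_⟩
  · intro a b
    constructor
    · intro hab
      have := OrderHomClass.mono ψ (show φ a ≤ φ b from hab)
      rwa [e1, e1] at this
    · intro hab
      exact OrderHomClass.mono φ hab
  · intro i
    exact hφ (Tm.var i)

end FreeRep

section dBarLemmas

variable {F : Type*} [Lattice F] (δ : F ≃o Fᵒᵈ)

theorem dBar_sup (a b : F) : dBar δ (a ⊔ b) = dBar δ a ⊓ dBar δ b := by
  simp [dBar, map_sup]

theorem dBar_inf (a b : F) : dBar δ (a ⊓ b) = dBar δ a ⊔ dBar δ b := by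
  simp [dBar, map_inf]

theorem dBar_anti {a b : F} (h : a ≤ b) : dBar δ b ≤ dBar δ a := by
  have : δ a ≤ δ b := δ.monotone h
  exact this

theorem dBar_dBar {α : Type*} {x : α → F} (h : FreeRep x) (hδ : ∀ i, dBar δ (x i) = x i) (u : F) :
    dBar δ (dBar δ u) = u := by
  obtain ⟨t, rfl⟩ := h.surj u
  have hd : (t.dual).dual = t := by induction t <;> simp_all [Tm.dual]
  rw [Tm.anti_eval (dBar δ) (dBar_sup δ) (dBar_inf δ),
    Tm.anti_eval (dBar δ) (dBar_sup δ) (dBar_inf δ), hd]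
  simp [hδ]

end dBarLemmas

/-! ### The forward direction -/

theorem not_symm_of_infinite {α F : Type*} [Lattice F] {x : α → F} (h : FreeRep x) [Infinite α]
    (u : F) : ¬ IsSymmElem u := by
  classical
  intro hu
  obtain ⟨t, rfl⟩ := h.surj u
  have hfin := t.vars_finite
  obtain ⟨S', hS', hcard⟩ := hfin.infinite_compl.exists_subset_card_eq hfin.toFinset.card
  let e1 : Fin hfin.toFinset.card ↪ α :=
    hfin.toFinset.equivFin.symm.toEmbedding.trans (Function.Embedding.subtype _)
  let e2 : Fin hfin.toFinset.card ↪ α :=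
    (S'.equivFinOfCardEq hcard).symm.toEmbedding.trans (Function.Embedding.subtype _)
  have := Equiv.Perm.isMultiplyPretransitive α hfin.toFinset.card
  obtain ⟨σ, hσ⟩ := MulAction.exists_smul_eq (Equiv.Perm α) e1 e2
  have hσ2 : ∀ a ∈ t.vars, σ a ∉ t.vars := by
    intro a ha
    have ha' : a ∈ hfin.toFinset := by simpa using ha
    have h1 := congrArg (fun e : Fin hfin.toFinset.card ↪ α => e (hfin.toFinset.equivFin ⟨a, ha'⟩)) hσ
    have h2 : σ a = e2 (hfin.toFinset.equivFin ⟨a, ha'⟩) := by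
      rw [← h1]
      simp [e1]
    rw [h2]
    have : e2 (hfin.toFinset.equivFin ⟨a, ha'⟩) ∈ S' := by
      simp [e2]
    exact hS' this
  obtain ⟨π, hπ⟩ := h.exists_auto σ
  have h1 := hu π
  rw [Tm.map_eval π (map_sup π) (map_inf π)] at h1
  simp only [hπ] at h1
  have h2 : Tm.eval x t = Tm.eval x (Tm.map σ t) := by
    rw [Tm.eval_map]; exact h1.symm
  have h3 : Tm.eval (fun a => a ∈ t.vars) t = Tm.eval (fun a => a ∈ t.vars) (Tm.map σ t) :=
    h.eval_eq _ h2
  have T1 : ∀ (s : Tm α) (V : Set α), s.vars ⊆ V → Tm.eval (fun a => a ∈ V) s := by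
    intro s V
    induction s with
    | var a => intro h; exact h rfl
    | sup s t h1 h2 => intro h; exact Or.inl (h1 (fun a ha => h (Or.inl ha)))
    | inf s t h1 h2 =>
      intro h; exact ⟨h1 (fun a ha => h (Or.inl ha)), h2 (fun a ha => h (Or.inr ha))⟩
  have T2 : ∀ (s : Tm α) (V : Set α), (∀ a ∈ s.vars, σ a ∉ V) →
      ¬ Tm.eval (fun a => a ∈ V) (Tm.map σ s) := by
    intro s V
    induction s with
    | var a => intro h; exact h _ rfl
    | sup s t h1 h2 =>
      intro h hh
      rcases hh with hh | hh
      · exact h1 (fun a ha => h a (Or.inl ha)) hh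
      · exact h2 (fun a ha => h a (Or.inr ha)) hh
    | inf s t h1 h2 => intro h hh; exact h1 (fun a ha => h a (Or.inl ha)) hh.1
  exact T2 t t.vars hσ2 (h3 ▸ T1 t t.vars subset_rfl)

theorem not_symm_selfdual {α F : Type*} [Lattice F] {x : α → F} (h : FreeRep x) [Nontrivial α]
    (δ : F ≃o Fᵒᵈ) (hδ : ∀ i, dBar δ (x i) = x i) (u : F) (hu : IsSymmElem u)
    (hd : dBar δ u = u) : False := by
  classical
  have hs : ∀ a b, u = a ⊔ b → u = a ∨ u = b := by
    intro a b hab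
    have h2 : u = dBar δ a ⊓ dBar δ b := by rw [← dBar_sup, ← hab, hd]
    have ha : a ≤ u := hab ▸ le_sup_left
    have hb : b ≤ u := hab ▸ le_sup_right
    have ha' : u ≤ dBar δ a := hd ▸ dBar_anti δ ha
    have hb' : u ≤ dBar δ b := hd ▸ dBar_anti δ hb
    rcases h.whit (dBar δ a) (dBar δ b) a b (by rw [← h2, ← hab]) with h | h | h' | h'
    · left
      have : dBar δ a = u := le_antisymm (hab ▸ h) ha'
      rw [← dBar_dBar δ ‹FreeRep x› hδ a, this, hd]
    · right
      have : dBar δ b = u := le_antisymm (hab ▸ h) hb'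
      rw [← dBar_dBar δ ‹FreeRep x› hδ b, this, hd]
    · left; rw [← h2] at h'; exact le_antisymm h' ha
    · right; rw [← h2] at h'; exact le_antisymm h' hb
  have hi : ∀ a b, u = a ⊓ b → u = a ∨ u = b := by
    intro a b hab
    have h2 : u = dBar δ a ⊔ dBar δ b := by rw [← dBar_inf, ← hab, hd]
    rcases hs _ _ h2 with h' | h'
    · left; rw [← dBar_dBar δ h hδ a, ← h', hd]
    · right; rw [← dBar_dBar δ h hδ b, ← h', hd]
  obtain ⟨i, rfl⟩ := h.mem_range hs hi
  obtain ⟨j, hj⟩ := exists_ne i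
  obtain ⟨π, hπ⟩ := h.exists_auto (Equiv.swap i j)
  have := hu π
  rw [hπ, Equiv.swap_apply_left] at this
  exact hj (h.inj this)

theorem forward_involution {α F ρ G : Type*} [Lattice F] [Lattice G] {x : α → F} {y : ρ → G}
    (h : FreeRep x) (hy : FreeRep y) (δ : F ≃o Fᵒᵈ) (hδ : ∀ i, dBar δ (x i) = x i)
    (φ : LatticeHom G F) (hφ : Function.Injective φ)
    (hself : SelfduallyPositioned δ (Set.range ⇑φ)) :
    ∃ τ : ρ → ρ, (∀ r, τ (τ r) = r) ∧ ∀ r, dBar δ (φ (y r)) = φ (y (τ r)) := by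
  have hD : ∀ g : G, ∃ g', dBar δ (φ g) = φ g' := by
    intro g
    have : dBar δ (φ g) ∈ Set.range ⇑φ := by
      rw [← hself]; exact ⟨_, ⟨g, rfl⟩, rfl⟩
    obtain ⟨g', hg'⟩ := this
    exact ⟨g', hg'.symm⟩
  choose D hD using hD
  have DD : ∀ g, D (D g) = g := fun g => hφ (by rw [← hD, ← hD, dBar_dBar δ h hδ])
  have Ds : ∀ a b, D (a ⊔ b) = D a ⊓ D b := fun a b => hφ (by
    rw [← hD, map_sup, dBar_sup, hD, hD, map_inf])
  have Di : ∀ a b, D (a ⊓ b) = D a ⊔ D b := fun a b => hφ (by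
    rw [← hD, map_inf, dBar_inf, hD, hD, map_sup])
  have hgen : ∀ r, ∃ r', D (y r) = y r' := by
    intro r
    apply hy.mem_range
    · intro a b hab
      have : y r = D a ⊓ D b := by rw [← Ds, ← hab, DD]
      rcases hy.inf_irred r _ _ this with h | h <;> simp [h, DD]
    · intro a b hab
      have : y r = D a ⊔ D b := by rw [← Di, ← hab, DD]
      rcases hy.sup_irred r _ _ this with h | h <;> simp [h, DD]
  choose τ hτ using hgen
  refine ⟨τ, fun r => hy.inj ?_, fun r => by rw [hD, hτ]⟩
  rw [← hτ, ← hτ, DD]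

/-! ### Independent families generate free sublattices -/

/-- Every member of the family is separated from above from the other members. -/
def Up {J L : Type*} [Lattice L] (z : J → L) : Prop :=
  ∀ j, ∃ s, (∀ k, k ≠ j → z k ≤ s) ∧ ¬ z j ≤ s

/-- The dual of `Up`. -/
def Dn {J L : Type*} [Lattice L] (z : J → L) : Prop :=
  ∀ j, ∃ s, (∀ k, k ≠ j → s ≤ z k) ∧ ¬ s ≤ z j

theorem Up.dn {J L : Type*} [Lattice L] {z : J → L} (h : Up z) (D : L → L) (hD : Antitone D)
    (hDD : ∀ u, D (D u) = u) (τ : J → J) (hτ : ∀ j, τ (τ j) = j) (hz : ∀ j, D (z j) = z (τ j)) :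
    Dn z := by
  intro j
  obtain ⟨s, h1, h2⟩ := h (τ j)
  refine ⟨D s, fun k hk => ?_, fun hj => h2 ?_⟩
  · have h3 := hD (h1 (τ k) (fun e => hk (by rw [← hτ k, e, hτ])))
    rwa [hz, hτ] at h3
  · have h3 := hD hj
    rwa [hz, hDD] at h3

theorem Up.prime {J L : Type*} [Lattice L] {z : J → L} (h : Up z) (j : J) (s t : Tm J)
    (hle : z j ≤ Tm.eval z (s.sup t)) : z j ≤ Tm.eval z s ∨ z j ≤ Tm.eval z t := by
  obtain ⟨m, h1, h2⟩ := h j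
  have key : ∀ t : Tm J, z j ≤ Tm.eval z t ∨ Tm.eval z t ≤ m := by
    intro t
    induction t with
    | var k =>
      by_cases hk : k = j
      · subst hk; exact Or.inl le_rfl
      · exact Or.inr (h1 k hk)
    | sup s t hs ht =>
      rcases hs with hs | hs
      · exact Or.inl (hs.trans le_sup_left)
      · rcases ht with ht | ht
        · exact Or.inl (ht.trans le_sup_right)
        · exact Or.inr (sup_le hs ht)
    | inf s t hs ht =>
      rcases hs with hs | hs
      · rcases ht with ht | ht
        · exact Or.inl (le_inf hs ht)
        · exact Or.inr (inf_le_right.trans ht)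
      · exact Or.inr (inf_le_left.trans hs)
  rcases key s with hs | hs
  · exact Or.inl hs
  · rcases key t with ht | ht
    · exact Or.inr ht
    · exact absurd (hle.trans (sup_le hs ht)) h2

theorem Dn.prime {J L : Type*} [Lattice L] {z : J → L} (h : Dn z) (j : J) (s t : Tm J)
    (hle : Tm.eval z (s.inf t) ≤ z j) : Tm.eval z s ≤ z j ∨ Tm.eval z t ≤ z j := by
  obtain ⟨m, h1, h2⟩ := h j
  have key : ∀ t : Tm J, Tm.eval z t ≤ z j ∨ m ≤ Tm.eval z t := by
    intro t
    induction t with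
    | var k =>
      by_cases hk : k = j
      · subst hk; exact Or.inl le_rfl
      · exact Or.inr (h1 k hk)
    | inf s t hs ht =>
      rcases hs with hs | hs
      · exact Or.inl (inf_le_left.trans hs)
      · rcases ht with ht | ht
        · exact Or.inl (inf_le_right.trans ht)
        · exact Or.inr (le_inf hs ht)
    | sup s t hs ht =>
      rcases hs with hs | hs
      · rcases ht with ht | ht
        · exact Or.inl (sup_le hs ht)
        · exact Or.inr (ht.trans le_sup_right)
      · exact Or.inr (hs.trans le_sup_left)
  rcases key s with hs | hs
  · exact Or.inl hs
  · rcases key t with ht | ht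
    · exact Or.inr ht
    · exact absurd ((le_inf hs ht).trans hle) h2

theorem le_of_indep {J L : Type*} [Lattice L] (hW : Whit L) {z : J → L} (hu : Up z) (hd : Dn z) :
    ∀ s t : Tm J, Tm.eval z s ≤ Tm.eval z t → Tm.Le s t := by
  intro s
  induction s with
  | var j =>
    intro t
    induction t with
    | var k =>
      intro h
      obtain ⟨m, h1, h2⟩ := hu j
      by_cases hk : k = j
      · subst hk; exact Tm.Le.var _
      · exact absurd (le_trans h (h1 k hk)) h2
    | sup a b ha hb =>
      intro h
      rcases hu.prime j a b h with h | h
      · exact (ha h).supR1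
      · exact (hb h).supR2
    | inf a b ha hb =>
      intro h
      exact Tm.Le.infR (ha (le_trans h inf_le_left)) (hb (le_trans h inf_le_right))
  | sup a b ha hb =>
    intro t h
    exact Tm.Le.supL (ha t (le_trans le_sup_left h)) (hb t (le_trans le_sup_right h))
  | inf a b ha hb =>
    intro t
    induction t with
    | var k =>
      intro h
      rcases hd.prime k a b h with h | h
      · exact (ha (Tm.var k) h).infL1
      · exact (hb (Tm.var k) h).infL2
    | sup c d hc hd =>
      intro h
      rcases hW _ _ _ _ h with h | h | h | h
      · exact (ha (Tm.sup c d) h).infL1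
      · exact (hb (Tm.sup c d) h).infL2
      · exact (hc h).supR1
      · exact (hd h).supR2
    | inf c d hc hd =>
      intro h
      exact Tm.Le.infR (hc (le_trans h inf_le_left)) (hd (le_trans h inf_le_right))

/-! ### An infinite selfdual independent family in the free lattice on four generators -/

/-- the swap of the generators -/
def sw (a : Bool × Bool) : Bool × Bool := (a.1, !a.2)

/-- The six terms in four variables. -/
def pt : Fin 3 × Bool → Tm (Bool × Bool)
  | (0, false) => .inf (.var (true, true)) (.sup (.var (false, false)) (.var (false, true)))
  | (1, false) => .inf (.var (true, true)) (.sup (.var (false, true))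
      (.inf (.var (true, false)) (.var (true, true))))
  | (2, false) => .inf (.var (true, true)) (.sup (.var (false, false))
      (.inf (.var (true, false)) (.var (true, true))))
  | (0, true) => .sup (.var (true, false)) (.inf (.var (false, true)) (.var (false, false)))
  | (1, true) => .sup (.var (true, false)) (.inf (.var (false, false))
      (.sup (.var (true, true)) (.var (true, false))))
  | (2, true) => .sup (.var (true, false)) (.inf (.var (false, true))
      (.sup (.var (true, true)) (.var (true, false))))

theorem pt_dual (a : Fin 3 × Bool) : (pt a).dual.map sw = pt (a.1, !a.2) := by
  obtain ⟨i, b⟩ := a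
  fin_cases i <;> cases b <;> rfl

/-- the join of the five other terms -/
def ptSep : Fin 3 × Bool → Tm (Bool × Bool)
  | (0, false) => .sup (pt (1, false)) (.sup (pt (2, false)) (.sup (pt (0, true))
      (.sup (pt (1, true)) (pt (2, true)))))
  | (1, false) => .sup (pt (0, false)) (.sup (pt (2, false)) (.sup (pt (0, true))
      (.sup (pt (1, true)) (pt (2, true)))))
  | (2, false) => .sup (pt (0, false)) (.sup (pt (1, false)) (.sup (pt (0, true))
      (.sup (pt (1, true)) (pt (2, true)))))
  | (0, true) => .sup (pt (0, false)) (.sup (pt (1, false)) (.sup (pt (2, false))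
      (.sup (pt (1, true)) (pt (2, true)))))
  | (1, true) => .sup (pt (0, false)) (.sup (pt (1, false)) (.sup (pt (2, false))
      (.sup (pt (0, true)) (pt (2, true)))))
  | (2, true) => .sup (pt (0, false)) (.sup (pt (1, false)) (.sup (pt (2, false))
      (.sup (pt (0, true)) (pt (1, true)))))

theorem pt_not_le (a : Fin 3 × Bool) : ¬ Tm.Le (pt a) (ptSep a) := by
  obtain ⟨i, b⟩ := a
  fin_cases i <;> cases b <;>
  simp [ptSep, pt, Tm.Le.sup_iff, Tm.Le.inf_iff, Tm.Le.var_var_iff, Tm.Le.var_sup_iff,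
    Tm.Le.inf_var_iff, Tm.Le.inf_sup_iff]

theorem pt_le (a k : Fin 3 × Bool) (h : k ≠ a) : Tm.Le (pt k) (ptSep a) := by
  have r := fun k => Tm.Le.rfl' (pt k)
  have s1 : ∀ {s t r : Tm (Bool × Bool)}, Tm.Le r s → Tm.Le r (Tm.sup s t) := Tm.Le.supR1
  have s2 : ∀ {s t r : Tm (Bool × Bool)}, Tm.Le r t → Tm.Le r (Tm.sup s t) := Tm.Le.supR2
  obtain ⟨i, b⟩ := a
  obtain ⟨k, c⟩ := k
  fin_cases i <;> cases b <;> fin_cases k <;> cases c <;>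
  first
  | exact absurd rfl h
  | exact s1 (r _)
  | exact s2 (s1 (r _))
  | exact s2 (s2 (s1 (r _)))
  | exact s2 (s2 (s2 (s1 (r _))))
  | exact s2 (s2 (s2 (s2 (r _))))

/-- the six elements -/
def pe (a : Fin 3 × Bool) : FL (Bool × Bool) := FL.mk (pt a)

theorem pe_up : Up pe := fun j =>
  ⟨FL.mk (ptSep j), fun k hk => FL.mk_le.2 (pt_le j k hk), fun h => pt_not_le j (FL.mk_le.1 h)⟩

/-- The dual automorphism of the free lattice on four generators. -/
theorem exists_D4 : ∃ D : FL (Bool × Bool) → FL (Bool × Bool), Antitone D ∧ (∀ u, D (D u) = u) ∧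
    ∀ t : Tm (Bool × Bool), D (FL.mk t) = FL.mk (t.dual.map sw) := by
  obtain ⟨φ, hφ⟩ := (FL.freeRep (Bool × Bool)).exists_lift
    (K := (FL (Bool × Bool))ᵒᵈ) (fun a => OrderDual.toDual (FL.of (sw a)))
  have h : ∀ t : Tm (Bool × Bool), OrderDual.ofDual (φ (FL.mk t)) = FL.mk (t.dual.map sw) := by
    intro t
    rw [← FL.eval_of, hφ, Tm.anti_eval (K := (FL (Bool × Bool))ᵒᵈ) OrderDual.ofDual
      (fun _ _ => rfl) (fun _ _ => rfl), ← FL.eval_of, Tm.eval_map]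
    rfl
  refine ⟨fun u => OrderDual.ofDual (φ u), fun a b hab => OrderHomClass.mono φ hab, ?_, h⟩
  intro u
  obtain ⟨t, rfl⟩ := FL.mk_surj u
  beta_reduce
  rw [h, h]
  congr 1
  induction t with
  | var a => simp [Tm.dual, Tm.map, sw]
  | sup s t hs ht => simp [Tm.dual, Tm.map, hs, ht]
  | inf s t hs ht => simp [Tm.dual, Tm.map, hs, ht]

theorem pe_dn : Dn pe := by
  obtain ⟨D, h1, h2, h3⟩ := exists_D4
  refine pe_up.dn D h1 h2 (fun a => (a.1, !a.2)) (by simp) ?_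
  intro j
  simp only [pe]
  rw [h3, pt_dual]

/-- the inclusion of the four generators in the six generators -/
def inc (a : Bool × Bool) : Fin 3 × Bool := (if a.1 then 2 else 1, a.2)

theorem exists_theta : ∃ θ : LatticeHom (FL (Bool × Bool)) (FL (Bool × Bool)),
    ∀ t, θ (FL.mk t) = Tm.eval (fun a => pe (inc a)) t := by
  obtain ⟨φ, hφ⟩ := (FL.freeRep (Bool × Bool)).exists_lift (fun a => pe (inc a))
  exact ⟨φ, fun t => by rw [← FL.eval_of, hφ]⟩

theorem theta_key (s t : Tm (Bool × Bool))
    (h : Tm.eval (fun a => pe (inc a)) s ≤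
      pe (0, false) ⊔ pe (0, true) ⊔ Tm.eval (fun a => pe (inc a)) t) : Tm.Le s t := by
  have h1 : Tm.eval pe (s.map inc) ≤
      Tm.eval pe (((Tm.var (0, false)).sup (Tm.var (0, true))).sup (t.map inc)) := by
    simp only [Tm.eval, Tm.eval_map]
    exact h
  have h2 := le_of_indep (FL.freeRep _).whit pe_up pe_dn _ _ h1
  let f : Fin 3 × Bool → WithBot (FL (Bool × Bool)) := fun a =>
    if a.1 = 0 then ⊥ else ((FL.of (decide (a.1 = 2), a.2) : FL (Bool × Bool)) : WithBot _)
  have hf : f ∘ inc = fun a => ((FL.of a : FL (Bool × Bool)) : WithBot (FL (Bool × Bool))) := by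
    funext a
    obtain ⟨i, b⟩ := a
    cases i <;> simp [f, inc]
  have h3 := h2.sound f
  simp only [Tm.eval, Tm.eval_map] at h3
  rw [hf] at h3
  have h4 : ∀ t, Tm.eval (fun a => ((FL.of a : FL (Bool × Bool)) : WithBot (FL (Bool × Bool)))) t =
      ((FL.mk t : FL (Bool × Bool)) : WithBot (FL (Bool × Bool))) := by
    intro t
    rw [← FL.eval_of, Tm.map_eval (fun u : FL (Bool × Bool) => (u : WithBot (FL (Bool × Bool))))
      (fun _ _ => rfl) (fun _ _ => rfl)]
  rw [h4, h4] at h3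
  simp only [f, if_true, bot_sup_eq] at h3
  exact FL.mk_le.1 (WithBot.coe_le_coe.1 h3)

/-- the infinite family -/
theorem exists_family4 : ∃ c : ℕ × Bool → FL (Bool × Bool), Up c ∧
    ∃ D : FL (Bool × Bool) → FL (Bool × Bool),
    (∀ t : Tm (Bool × Bool), D (FL.mk t) = FL.mk (t.dual.map sw)) ∧
    (∀ n b, D (c (n, b)) = c (n, !b)) ∧ Dn c := by
  obtain ⟨θ, hθ⟩ := exists_theta
  obtain ⟨D, h1, h2, h3⟩ := exists_D4
  have hpe : ∀ i b, D (pe (i, b)) = pe (i, !b) := by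
    intro i b
    simp only [pe]
    rw [h3, pt_dual]
  let c : ℕ × Bool → FL (Bool × Bool) := fun p => θ^[p.1] (pe (0, p.2))
  have c0 : ∀ b, c (0, b) = pe (0, b) := fun _ => rfl
  have cs : ∀ n b, c (n + 1, b) = θ (c (n, b)) := fun n b => Function.iterate_succ_apply' _ _ _
  have hkey : ∀ u v, θ u ≤ pe (0, false) ⊔ pe (0, true) ⊔ θ v → u ≤ v := by
    intro u v h
    obtain ⟨s, rfl⟩ := FL.mk_surj u
    obtain ⟨t, rfl⟩ := FL.mk_surj v
    rw [hθ, hθ] at h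
    exact FL.mk_le.2 (theta_key s t h)
  have hDθ : ∀ u, D (θ u) = θ (D u) := by
    intro u
    obtain ⟨t, rfl⟩ := FL.mk_surj u
    have hDs : ∀ a b, D (a ⊔ b) = D a ⊓ D b := by
      intro a b
      obtain ⟨s, rfl⟩ := FL.mk_surj a
      obtain ⟨t, rfl⟩ := FL.mk_surj b
      rw [← FL.mk_sup, h3, h3, h3, ← FL.mk_inf]; rfl
    have hDi : ∀ a b, D (a ⊓ b) = D a ⊔ D b := by
      intro a b
      obtain ⟨s, rfl⟩ := FL.mk_surj a
      obtain ⟨t, rfl⟩ := FL.mk_surj b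
      rw [← FL.mk_inf, h3, h3, h3, ← FL.mk_sup]; rfl
    rw [hθ, Tm.anti_eval D hDs hDi, h3, hθ, Tm.eval_map]
    congr 1
    funext a
    exact hpe _ _
  have hDc : ∀ n b, D (c (n, b)) = c (n, !b) := by
    intro n b
    induction n with
    | zero => exact hpe 0 b
    | succ n ih => rw [cs, cs, hDθ, ih]
  have hup : Up c := by
    rintro ⟨n, b⟩
    induction n with
    | zero =>
      obtain ⟨s, hs1, hs2⟩ := pe_up (0, b)
      refine ⟨s, ?_, hs2⟩
      rintro ⟨k, b'⟩ hk
      cases k with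
      | zero =>
        rw [c0]
        apply hs1
        intro e
        apply hk
        simpa using e
      | succ k =>
        rw [cs]
        obtain ⟨t, ht⟩ := FL.mk_surj (c (k, b'))
        rw [← ht, hθ]
        apply Tm.eval_le
        intro a
        apply hs1
        obtain ⟨a1, a2⟩ := a
        cases a1 <;> simp [inc]
    | succ n ih =>
      obtain ⟨s, hs1, hs2⟩ := ih
      refine ⟨pe (0, false) ⊔ pe (0, true) ⊔ θ s, ?_, ?_⟩
      · rintro ⟨k, b'⟩ hk
        cases k with
        | zero =>
          rw [c0]
          cases b'
          · exact le_sup_of_le_left le_sup_left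
          · exact le_sup_of_le_left le_sup_right
        | succ k =>
          rw [cs]
          refine le_sup_of_le_right (OrderHomClass.mono θ (hs1 _ ?_))
          intro e
          apply hk
          simpa using e
      · rw [cs]
        intro h
        exact hs2 (hkey _ _ h)
  exact ⟨c, hup, D, h3, hDc,
    hup.dn D h1 h2 (fun p => (p.1, !p.2)) (by simp) (fun p => hDc p.1 p.2)⟩

/-! ### Four symmetric independent elements -/

section finsetW

variable {F α : Type*} [Lattice F] {x : α → F} {ι κ : Type*}

theorem FreeRep.le_sup' (h : FreeRep x) (k : α) {s : Finset ι} (hs : s.Nonempty) (f : ι → F)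
    (hle : x k ≤ s.sup' hs f) : ∃ j ∈ s, x k ≤ f j := by
  induction hs using Finset.Nonempty.cons_induction with
  | singleton a => exact ⟨a, by simp, by simpa using hle⟩
  | cons a s ha hs ih =>
    rw [Finset.sup'_cons hs, h.sup_prime] at hle
    rcases hle with hle | hle
    · exact ⟨a, by simp, hle⟩
    · obtain ⟨j, hj, hj2⟩ := ih hle
      exact ⟨j, by simp [hj], hj2⟩

theorem FreeRep.inf'_le (h : FreeRep x) (k : α) {s : Finset ι} (hs : s.Nonempty) (f : ι → F)
    (hle : s.inf' hs f ≤ x k) : ∃ j ∈ s, f j ≤ x k := by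
  induction hs using Finset.Nonempty.cons_induction with
  | singleton a => exact ⟨a, by simp, by simpa using hle⟩
  | cons a s ha hs ih =>
    rw [Finset.inf'_cons hs, h.inf_prime] at hle
    rcases hle with hle | hle
    · exact ⟨a, by simp, hle⟩
    · obtain ⟨j, hj, hj2⟩ := ih hle
      exact ⟨j, by simp [hj], hj2⟩

theorem Whit.inf' (hW : Whit F) {s : Finset ι} (hs : s.Nonempty) (p : ι → F) (c d : F)
    (hle : s.inf' hs p ≤ c ⊔ d) :
    (∃ i ∈ s, p i ≤ c ⊔ d) ∨ s.inf' hs p ≤ c ∨ s.inf' hs p ≤ d := by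
  induction hs using Finset.Nonempty.cons_induction with
  | singleton a => exact Or.inl ⟨a, by simp, by simpa using hle⟩
  | cons a s ha hs ih =>
    rw [Finset.inf'_cons hs] at hle ⊢
    rcases hW _ _ _ _ hle with h | h | h | h
    · exact Or.inl ⟨a, by simp, h⟩
    · rcases ih h with ⟨j, hj, hj2⟩ | h | h
      · exact Or.inl ⟨j, by simp [hj], hj2⟩
      · exact Or.inr (Or.inl (inf_le_right.trans h))
      · exact Or.inr (Or.inr (inf_le_right.trans h))
    · exact Or.inr (Or.inl h)
    · exact Or.inr (Or.inr h)

theorem Whit.sup' (hW : Whit F) {t : Finset ι} (ht : t.Nonempty) (q : ι → F) (a b : F)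
    (hle : a ⊓ b ≤ t.sup' ht q) :
    a ≤ t.sup' ht q ∨ b ≤ t.sup' ht q ∨ ∃ j ∈ t, a ⊓ b ≤ q j := by
  induction ht using Finset.Nonempty.cons_induction with
  | singleton c => exact Or.inr (Or.inr ⟨c, by simp, by simpa using hle⟩)
  | cons c t hc ht ih =>
    rw [Finset.sup'_cons ht] at hle ⊢
    rcases hW _ _ _ _ hle with h | h | h | h
    · exact Or.inl h
    · exact Or.inr (Or.inl h)
    · exact Or.inr (Or.inr ⟨c, by simp, h⟩)
    · rcases ih h with h | h | ⟨j, hj, hj2⟩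
      · exact Or.inl (le_sup_of_le_right h)
      · exact Or.inr (Or.inl (le_sup_of_le_right h))
      · exact Or.inr (Or.inr ⟨j, by simp [hj], hj2⟩)

theorem Whit.inf'_sup' (hW : Whit F) {s : Finset κ} (hs : s.Nonempty) (p : κ → F)
    {t : Finset ι} (ht : t.Nonempty) (q : ι → F) (hle : s.inf' hs p ≤ t.sup' ht q) :
    (∃ i ∈ s, p i ≤ t.sup' ht q) ∨ ∃ j ∈ t, s.inf' hs p ≤ q j := by
  induction hs using Finset.Nonempty.cons_induction with
  | singleton a => exact Or.inl ⟨a, by simp, by simpa using hle⟩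
  | cons a s ha hs ih =>
    rw [Finset.inf'_cons hs] at hle ⊢
    rcases hW.sup' _ _ _ _ hle with h | h | h
    · exact Or.inl ⟨a, by simp, h⟩
    · rcases ih h with ⟨j, hj, hj2⟩ | ⟨j, hj, h⟩
      · exact Or.inl ⟨j, by simp [hj], hj2⟩
      · exact Or.inr ⟨j, hj, inf_le_right.trans h⟩
    · exact Or.inr h

theorem anti_sup' {L : Type*} [Lattice L] (D : F → L) (hD : ∀ a b, D (a ⊔ b) = D a ⊓ D b)
    {s : Finset ι} (hs : s.Nonempty) (f : ι → F) :
    D (s.sup' hs f) = s.inf' hs (fun i => D (f i)) := by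
  induction hs using Finset.Nonempty.cons_induction with
  | singleton a => simp
  | cons a s ha hs ih => rw [Finset.sup'_cons hs, Finset.inf'_cons hs, hD, ih]

theorem anti_inf' {L : Type*} [Lattice L] (D : F → L) (hD : ∀ a b, D (a ⊓ b) = D a ⊔ D b)
    {s : Finset ι} (hs : s.Nonempty) (f : ι → F) :
    D (s.inf' hs f) = s.sup' hs (fun i => D (f i)) := by
  induction hs using Finset.Nonempty.cons_induction with
  | singleton a => simp
  | cons a s ha hs ih => rw [Finset.inf'_cons hs, Finset.sup'_cons hs, hD, ih]

end finsetW

section four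

variable {ι F : Type*} [Fintype ι] [DecidableEq ι] [Nontrivial ι] [Lattice F]

theorem ern (i : ι) : (Finset.univ.erase i).Nonempty := by
  obtain ⟨j, hj⟩ := exists_ne i
  exact ⟨j, by simp [hj]⟩

/-- join over all `j ≠ i` -/
def exS (f : ι → F) (i : ι) : F := (Finset.univ.erase i).sup' (ern i) f
/-- meet over all `j ≠ i` -/
def exI (f : ι → F) (i : ι) : F := (Finset.univ.erase i).inf' (ern i) f
/-- join over all `j` -/
def bigS (f : ι → F) : F := Finset.univ.sup' Finset.univ_nonempty f
/-- meet over all `j` -/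
def bigI (f : ι → F) : F := Finset.univ.inf' Finset.univ_nonempty f

theorem le_exS (f : ι → F) {i j : ι} (h : j ≠ i) : f j ≤ exS f i :=
  Finset.le_sup' f (by simp [h])
theorem exI_le (f : ι → F) {i j : ι} (h : j ≠ i) : exI f i ≤ f j :=
  Finset.inf'_le f (by simp [h])
theorem exS_le {f : ι → F} {i : ι} {c : F} (h : ∀ j, j ≠ i → f j ≤ c) : exS f i ≤ c :=
  Finset.sup'_le _ _ (by simpa using h)
theorem le_exI {f : ι → F} {i : ι} {c : F} (h : ∀ j, j ≠ i → c ≤ f j) : c ≤ exI f i :=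
  Finset.le_inf' _ _ (by simpa using h)
theorem le_bigS (f : ι → F) (i : ι) : f i ≤ bigS f := Finset.le_sup' f (by simp)
theorem bigI_le (f : ι → F) (i : ι) : bigI f ≤ f i := Finset.inf'_le f (by simp)
theorem bigS_le {f : ι → F} {c : F} (h : ∀ j, f j ≤ c) : bigS f ≤ c :=
  Finset.sup'_le _ _ (by simpa using h)
theorem le_bigI {f : ι → F} {c : F} (h : ∀ j, c ≤ f j) : c ≤ bigI f :=
  Finset.le_inf' _ _ (by simpa using h)

theorem exS_perm (π : F ≃o F) (σ : Equiv.Perm ι) (f : ι → F) (h : ∀ i, π (f i) = f (σ i)) (i : ι) :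
    π (exS f i) = exS f (σ i) := by
  apply le_antisymm
  · rw [← OrderIso.le_symm_apply]
    refine exS_le fun j hj => ?_
    rw [OrderIso.le_symm_apply, h]
    exact le_exS f (by simpa using hj)
  · refine exS_le fun j hj => ?_
    have : f j = π (f (σ.symm j)) := by rw [h]; simp
    rw [this]
    refine π.monotone (le_exS f ?_)
    rintro rfl
    simp at hj

theorem exI_perm (π : F ≃o F) (σ : Equiv.Perm ι) (f : ι → F) (h : ∀ i, π (f i) = f (σ i)) (i : ι) :
    π (exI f i) = exI f (σ i) := by
  apply le_antisymm
  · refine le_exI fun j hj => ?_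
    have : f j = π (f (σ.symm j)) := by rw [h]; simp
    rw [this]
    refine π.monotone (exI_le f ?_)
    rintro rfl
    simp at hj
  · rw [← OrderIso.symm_apply_le]
    refine le_exI fun j hj => ?_
    rw [OrderIso.symm_apply_le, h]
    exact exI_le f (by simpa using hj)

theorem bigS_perm (π : F ≃o F) (σ : Equiv.Perm ι) (f : ι → F) (h : ∀ i, π (f i) = f (σ i)) :
    π (bigS f) = bigS f := by
  apply le_antisymm
  · rw [← OrderIso.le_symm_apply]
    refine bigS_le fun j => ?_
    rw [OrderIso.le_symm_apply, h]
    exact le_bigS f _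
  · refine bigS_le fun j => ?_
    have : f j = π (f (σ.symm j)) := by rw [h]; simp
    rw [this]
    exact π.monotone (le_bigS f _)

theorem bigI_perm (π : F ≃o F) (σ : Equiv.Perm ι) (f : ι → F) (h : ∀ i, π (f i) = f (σ i)) :
    π (bigI f) = bigI f := by
  apply le_antisymm
  · refine le_bigI fun j => ?_
    have : f j = π (f (σ.symm j)) := by rw [h]; simp
    rw [this]
    exact π.monotone (bigI_le f _)
  · rw [← OrderIso.symm_apply_le]
    refine le_bigI fun j => ?_
    rw [OrderIso.symm_apply_le, h]
    exact bigI_le f _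

theorem exists_sym4 {x : ι → F} (h : FreeRep x) (h3 : ∀ i j : ι, ∃ k, k ≠ i ∧ k ≠ j)
    (δ : F ≃o Fᵒᵈ) (hδ : ∀ i, dBar δ (x i) = x i) :
    ∃ z : Bool × Bool → F, Up z ∧ (∀ a, dBar δ (z a) = z (sw a)) ∧ ∀ a, IsSymmElem (z a) := by
  have hW := h.whit
  obtain ⟨X, hX⟩ : ∃ X, X = exS x := ⟨_, rfl⟩
  obtain ⟨M, hM⟩ : ∃ M, M = exI x := ⟨_, rfl⟩
  obtain ⟨u, hu⟩ : ∃ u : ι → F, u = fun i => x i ⊓ X i := ⟨_, rfl⟩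
  obtain ⟨v, hv⟩ : ∃ v : ι → F, v = fun i => x i ⊔ M i := ⟨_, rfl⟩
  obtain ⟨U, hU⟩ : ∃ U, U = exS u := ⟨_, rfl⟩
  obtain ⟨V, hV⟩ : ∃ V, V = exI v := ⟨_, rfl⟩
  obtain ⟨a1, ha1⟩ : ∃ a, a = bigI U := ⟨_, rfl⟩
  obtain ⟨b1, hb1⟩ : ∃ a, a = bigS V := ⟨_, rfl⟩
  obtain ⟨a2, ha2⟩ : ∃ a, a = bigI fun i => u i ⊔ V i := ⟨_, rfl⟩
  obtain ⟨b2, hb2⟩ : ∃ a, a = bigS fun i => v i ⊓ U i := ⟨_, rfl⟩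
  -- basic inequalities
  have Xge : ∀ {i j}, j ≠ i → x j ≤ X i := fun hij => hX ▸ le_exS x hij
  have Mle : ∀ {i j}, j ≠ i → M i ≤ x j := fun hij => hM ▸ exI_le x hij
  have Uge : ∀ {i j}, j ≠ i → u j ≤ U i := fun hij => hU ▸ le_exS u hij
  have Vle : ∀ {i j}, j ≠ i → V i ≤ v j := fun hij => hV ▸ exI_le v hij
  have ux' : ∀ i, u i ≤ x i := fun i => by rw [hu]; exact inf_le_left
  have uX : ∀ i, u i ≤ X i := fun i => by rw [hu]; exact inf_le_right
  have xv' : ∀ i, x i ≤ v i := fun i => by rw [hv]; exact le_sup_left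
  have Mv : ∀ i, M i ≤ v i := fun i => by rw [hv]; exact le_sup_right
  have a1U : ∀ i, a1 ≤ U i := fun i => ha1 ▸ bigI_le U i
  have a2V : ∀ i, a2 ≤ u i ⊔ V i := fun i => ha2 ▸ bigI_le (fun i => u i ⊔ V i) i
  have Vb1 : ∀ i, V i ≤ b1 := fun i => hb1 ▸ le_bigS V i
  have Ub2 : ∀ i, v i ⊓ U i ≤ b2 := fun i => hb2 ▸ le_bigS (fun i => v i ⊓ U i) i
  -- generators below things
  have xM : ∀ i j, ¬ x i ≤ M j := by
    intro i j hle
    obtain ⟨k, hk1, hk2⟩ := h3 i j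
    exact hk1 ((h.var_le i k).1 (hle.trans (Mle hk2))).symm
  have xX : ∀ i, ¬ x i ≤ X i := by
    intro i hle
    rw [hX] at hle
    obtain ⟨j, hj, hj2⟩ := h.le_sup' i _ _ hle
    rw [h.var_le] at hj2
    simp [hj2] at hj
  have xv : ∀ {i j}, x i ≤ v j → i = j := by
    intro i j hle
    rw [hv] at hle
    rcases (h.sup_prime i _ _).1 hle with h' | h'
    · exact (h.var_le i j).1 h'
    · exact absurd h' (xM _ _)
  have xu : ∀ i j, ¬ x i ≤ u j := by
    intro i j hle
    have := (h.var_le i j).1 (hle.trans (ux' j))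
    subst this
    exact xX i (hle.trans (uX i))
  have xV : ∀ i j, ¬ x i ≤ V j := by
    intro i j hle
    obtain ⟨k, hk1, hk2⟩ := h3 i j
    exact hk1 (xv (hle.trans (Vle hk2))).symm
  have xU : ∀ i j, ¬ x i ≤ U j := by
    intro i j hle
    rw [hU] at hle
    obtain ⟨k, hk, hk2⟩ := h.le_sup' i _ _ hle
    exact xu _ _ hk2
  have xuV : ∀ i j k, ¬ x i ≤ u j ⊔ V k := by
    intro i j k hle
    rcases (h.sup_prime i _ _).1 hle with h' | h'
    · exact xu _ _ h'
    · exact xV _ _ h'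
  have xa1 : ∀ i, ¬ x i ≤ a1 := fun i hle => xU _ _ (hle.trans (a1U i))
  have xa2 : ∀ i, ¬ x i ≤ a2 := fun i hle => xuV _ _ _ (hle.trans (a2V i))
  have xb1 : ∀ i, ¬ x i ≤ b1 := by
    intro i hle
    rw [hb1] at hle
    obtain ⟨k, hk, hk2⟩ := h.le_sup' i _ _ hle
    exact xV _ _ hk2
  have xb2 : ∀ i, ¬ x i ≤ b2 := by
    intro i hle
    rw [hb2] at hle
    obtain ⟨k, hk, hk2⟩ := h.le_sup' i _ _ hle
    exact xU _ _ (hk2.trans inf_le_right)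
  have xsup : ∀ {c d}, (∀ i, ¬ x i ≤ c) → (∀ i, ¬ x i ≤ d) → ∀ i, ¬ x i ≤ c ⊔ d := by
    intro c d hc hd i hle
    rcases (h.sup_prime i _ _).1 hle with h' | h'
    · exact hc i h'
    · exact hd i h'
  -- generators above things
  have Xx : ∀ i j, ¬ X i ≤ x j := by
    intro i j hle
    obtain ⟨k, hk1, hk2⟩ := h3 i j
    exact hk2 ((h.var_le k j).1 ((Xge hk1).trans hle))
  have Mx : ∀ i, ¬ M i ≤ x i := by
    intro i hle
    rw [hM] at hle
    obtain ⟨j, hj, hj2⟩ := h.inf'_le i _ _ hle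
    rw [h.var_le] at hj2
    simp [hj2] at hj
  have ux : ∀ {i j}, u i ≤ x j → i = j := by
    intro i j hle
    rw [hu] at hle
    rcases (h.inf_prime j _ _).1 hle with h' | h'
    · exact (h.var_le i j).1 h'
    · exact absurd h' (Xx _ _)
  have vx : ∀ i j, ¬ v i ≤ x j := by
    intro i j hle
    have := (h.var_le i j).1 ((xv' i).trans hle)
    subst this
    exact Mx i ((Mv i).trans hle)
  have Vx : ∀ i j, ¬ V i ≤ x j := by
    intro i j hle
    rw [hV] at hle
    obtain ⟨k, hk, hk2⟩ := h.inf'_le j _ _ hle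
    exact vx _ _ hk2
  have Ux : ∀ i j, ¬ U i ≤ x j := by
    intro i j hle
    obtain ⟨k, hk1, hk2⟩ := h3 i j
    exact hk2 (ux ((Uge hk1).trans hle))
  have vUx : ∀ k i j, ¬ v k ⊓ U i ≤ x j := by
    intro k i j hle
    rcases (h.inf_prime j _ _).1 hle with h' | h'
    · exact vx _ _ h'
    · exact Ux _ _ h'
  have a1x : ∀ i, ¬ a1 ≤ x i := by
    intro i hle
    rw [ha1] at hle
    obtain ⟨k, hk, hk2⟩ := h.inf'_le i _ _ hle
    exact Ux _ _ hk2
  have a2x : ∀ i, ¬ a2 ≤ x i := by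
    intro i hle
    rw [ha2] at hle
    obtain ⟨k, hk, hk2⟩ := h.inf'_le i _ _ hle
    exact Vx _ _ (le_sup_right.trans hk2)
  have Mlex : ∀ {c l}, c ≤ M l → ∃ k, k ≠ l ∧ c ≤ x k := by
    intro c l hle
    obtain ⟨k, hk, _⟩ := h3 l l
    exact ⟨k, hk, hle.trans (Mle hk)⟩
  -- Whitman for u and V
  have uW : ∀ {j c d}, (∀ i, ¬ x i ≤ c) → (∀ i, ¬ x i ≤ d) → u j ≤ c ⊔ d → u j ≤ c ∨ u j ≤ d := by
    intro j c d hc hd hle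
    rw [hu] at hle ⊢
    rcases hW _ _ _ _ hle with h' | h' | h' | h'
    · exact absurd h' (xsup hc hd j)
    · obtain ⟨k, hk, _⟩ := h3 j j
      exact absurd ((Xge hk).trans h') (xsup hc hd k)
    · exact Or.inl h'
    · exact Or.inr h'
  have uWS : ∀ {j} {t : Finset ι} {ht : t.Nonempty} {q : ι → F}, (∀ i, ¬ x i ≤ t.sup' ht q) →
      u j ≤ t.sup' ht q → ∃ k ∈ t, u j ≤ q k := by
    intro j t ht q hc hle
    rw [hu] at hle ⊢
    rcases hW.sup' _ _ _ _ hle with h' | h' | h'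
    · exact absurd h' (hc j)
    · obtain ⟨k, hk, _⟩ := h3 j j
      exact absurd ((Xge hk).trans h') (hc k)
    · exact h'
  have VW : ∀ {j c d}, (∀ i, ¬ x i ≤ c) → (∀ i, ¬ x i ≤ d) → V j ≤ c ⊔ d → V j ≤ c ∨ V j ≤ d := by
    intro j c d hc hd hle
    rw [hV] at hle ⊢
    rcases hW.inf' _ _ _ _ hle with ⟨k, _, h'⟩ | h'
    · exact absurd ((xv' k).trans h') (xsup hc hd k)
    · exact h'
  have VWS : ∀ {j} {t : Finset ι} {ht : t.Nonempty} {q : ι → F}, (∀ i, ¬ x i ≤ t.sup' ht q) →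
      V j ≤ t.sup' ht q → ∃ k ∈ t, V j ≤ q k := by
    intro j t ht q hc hle
    rw [hV] at hle ⊢
    rcases hW.inf'_sup' _ _ _ _ hle with ⟨k, _, h'⟩ | h'
    · exact absurd ((xv' k).trans h') (hc k)
    · exact h'
  -- facts about u
  have uv : ∀ {j l}, u j ≤ v l → j = l := by
    intro j l hle
    by_contra hjl
    rw [hu, hv] at hle
    rcases hW _ _ _ _ hle with h' | h' | h' | h'
    · exact hjl (xv (by rw [hv]; exact h'))
    · obtain ⟨k, hk1, hk2⟩ := h3 j l
      exact hk2 (xv (by rw [hv]; exact (Xge hk1).trans h'))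
    · exact hjl (ux (by rw [hu]; exact h'))
    · obtain ⟨k, hk1, hk2⟩ := h3 j l
      exact hk1 (ux (by rw [hu]; exact h'.trans (Mle hk2))).symm
  have uV : ∀ j k, ¬ u j ≤ V k := by
    intro j k hle
    obtain ⟨l, hl1, hl2⟩ := h3 j k
    exact hl1 (uv (hle.trans (Vle hl2))).symm
  have uU : ∀ j, ¬ u j ≤ U j := by
    intro j hle
    have hx := fun i => xU i j
    rw [hU] at hle hx
    obtain ⟨k, hk, hk2⟩ := uWS hx hle
    have := ux (hk2.trans (ux' k))
    simp [this] at hk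
  have ub1 : ∀ j, ¬ u j ≤ b1 := by
    intro j hle
    rw [hb1] at hle xb1
    obtain ⟨k, hk, hk2⟩ := uWS xb1 hle
    exact uV _ _ hk2
  have ub2 : ∀ j, ¬ u j ≤ b2 := by
    intro j hle
    rw [hb2] at hle xb2
    obtain ⟨k, hk, hk2⟩ := uWS xb2 hle
    have := uv (hk2.trans inf_le_left)
    subst this
    exact uU _ (hk2.trans inf_le_right)
  have ua1 : ∀ j, ¬ u j ≤ a1 := fun j hle => uU j (hle.trans (a1U j))
  have uuV : ∀ {j k}, j ≠ k → ¬ u j ≤ u k ⊔ V k := by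
    intro j k hjk hle
    rcases uW (fun i => xu i k) (fun i => xV i k) hle with h' | h'
    · exact hjk (ux (h'.trans (ux' k)))
    · exact uV _ _ h'
  have ua2 : ∀ j, ¬ u j ≤ a2 := by
    intro j hle
    obtain ⟨k, hk, _⟩ := h3 j j
    exact uuV hk.symm (hle.trans (a2V k))
  have usup : ∀ {c d}, (∀ i, ¬ x i ≤ c) → (∀ i, ¬ x i ≤ d) → (∀ j, ¬ u j ≤ c) →
      (∀ j, ¬ u j ≤ d) → ∀ j, ¬ u j ≤ c ⊔ d := by
    intro c d hc hd hc' hd' j hle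
    rcases uW hc hd hle with h' | h'
    · exact hc' j h'
    · exact hd' j h'
  have Usup : ∀ {c}, (∀ j, ¬ u j ≤ c) → ∀ i, ¬ U i ≤ c := by
    intro c hc i hle
    obtain ⟨k, hk, _⟩ := h3 i i
    exact hc k ((Uge hk).trans hle)
  have Uv : ∀ i l, ¬ U i ≤ v l := by
    intro i l hle
    obtain ⟨k, hk, hk2⟩ := h3 i l
    exact hk2 (uv ((Uge hk).trans hle))
  -- facts about V
  have Vv : ∀ l, ¬ V l ≤ v l := by
    intro l hle
    have hle' := hle
    rw [hV, hv] at hle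
    rcases hW.inf' _ _ _ _ hle with ⟨k, hk, h'⟩ | h' | h'
    · have := xv (show x k ≤ v l by rw [hv]; exact le_sup_left.trans h')
      simp [this] at hk
    · exact Vx l l (by rw [hV, hv]; exact h')
    · obtain ⟨k, _, hk⟩ := Mlex h'
      exact Vx l k (by rw [hV, hv]; exact hk)
  have VU : ∀ i k, ¬ V i ≤ U k := by
    intro i k hle
    have hx := fun i => xU i k
    rw [hU] at hle hx
    obtain ⟨k, hk, hk2⟩ := VWS hx hle
    exact Vx _ _ (hk2.trans (ux' k))
  have a1v : ∀ l, ¬ a1 ≤ v l := by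
    intro l hle
    rw [ha1, hv] at hle
    rcases hW.inf' _ _ _ _ hle with ⟨k, hk, h'⟩ | h' | h'
    · exact Uv k l (by rw [hv]; exact h')
    · exact a1x l (by rw [ha1]; exact h')
    · obtain ⟨k, _, hk⟩ := Mlex h'
      exact a1x k (by rw [ha1]; exact hk)
  have a2v : ∀ l, ¬ a2 ≤ v l := by
    intro l hle
    rw [ha2, hv] at hle
    rcases hW.inf' _ _ _ _ hle with ⟨k, hk, h'⟩ | h' | h'
    · have h'' : u k ⊔ V k ≤ v l := by rw [hv]; exact h'
      have := uv (le_sup_left.trans h'')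
      subst this
      exact Vv _ (le_sup_right.trans h'')
    · exact a2x l (by rw [ha2]; exact h')
    · obtain ⟨k, _, hk⟩ := Mlex h'
      exact a2x k (by rw [ha2]; exact hk)
  have wv : ∀ {k j}, k ≠ j → ¬ v k ⊓ U k ≤ v j := by
    intro k j hkj hle
    have e : v j = x j ⊔ M j := by rw [hv]
    rw [e] at hle
    rcases hW _ _ _ _ hle with h' | h' | h' | h'
    · exact hkj (xv ((xv' k).trans (e ▸ h')))
    · exact Uv k j (e ▸ h')
    · exact vUx _ _ _ h'
    · obtain ⟨l, _, hl⟩ := Mlex h'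
      exact vUx _ _ _ hl
  have wV : ∀ k l, ¬ v k ⊓ U k ≤ V l := by
    intro k l hle
    obtain ⟨j, hj1, hj2⟩ := h3 k l
    exact wv hj1.symm (hle.trans (Vle hj2))
  -- the four separations
  have hA : ¬ a1 ≤ a2 ⊔ (b1 ⊔ b2) := by
    intro hle
    have hx := xsup xa2 (xsup xb1 xb2)
    have hu' := usup xa2 (xsup xb1 xb2) ua2 (usup xb1 xb2 ub1 ub2)
    have h12 : a1 ≤ b1 ⊔ b2 → False := by
      intro hle
      have hu'' := usup xb1 xb2 ub1 ub2
      have q1 : ¬ a1 ≤ b1 := by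
        intro hle
        have hle' := hle
        rw [ha1, hb1] at hle
        rcases hW.inf'_sup' _ _ _ _ hle with ⟨i, _, h'⟩ | ⟨j, _, h'⟩
        · exact Usup ub1 i (by rw [hb1]; exact h')
        · obtain ⟨k, hk, _⟩ := h3 j j
          exact a1v k (by rw [ha1]; exact h'.trans (Vle hk))
      have q2 : ¬ a1 ≤ b2 := by
        intro hle
        rw [ha1, hb2] at hle
        rcases hW.inf'_sup' _ _ _ _ hle with ⟨i, _, h'⟩ | ⟨j, _, h'⟩
        · exact Usup ub2 i (by rw [hb2]; exact h')
        · exact a1v j (by rw [ha1]; exact h'.trans inf_le_left)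
      have hle' := hle
      rw [ha1] at hle'
      rcases hW.inf' _ _ _ _ hle' with ⟨k, hk, h'⟩ | h' | h'
      · exact Usup hu'' k h'
      · exact q1 (by rw [ha1]; exact h')
      · exact q2 (by rw [ha1]; exact h')
    have q3 : ¬ a1 ≤ a2 := by
      intro hle
      obtain ⟨k, _⟩ := exists_pair_ne ι
      have hle := hle.trans (a2V k)
      rw [ha1] at hle
      rcases hW.inf' _ _ _ _ hle with ⟨i, hi, h'⟩ | h' | h'
      · obtain ⟨j, hj1, hj2⟩ := h3 i k
        exact uuV hj2 ((Uge hj1).trans h')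
      · exact a1x k (by rw [ha1]; exact h'.trans (ux' k))
      · obtain ⟨l, hl, _⟩ := h3 k k
        exact a1v l (by rw [ha1]; exact h'.trans (Vle hl))
    have hle' := hle
    rw [ha1] at hle'
    rcases hW.inf' _ _ _ _ hle' with ⟨k, hk, h'⟩ | h' | h'
    · exact Usup hu' k h'
    · exact q3 (by rw [ha1]; exact h')
    · exact h12 (by rw [ha1]; exact h')
  have hB : ¬ a2 ≤ a1 ⊔ (b1 ⊔ b2) := by
    intro hle
    have hu'' := usup xb1 xb2 ub1 ub2
    have hu' := usup xa1 (xsup xb1 xb2) ua1 hu''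
    have q1 : ¬ a2 ≤ b1 := by
      intro hle
      rw [ha2, hb1] at hle
      rcases hW.inf'_sup' _ _ _ _ hle with ⟨i, _, h'⟩ | ⟨j, _, h'⟩
      · exact ub1 i (by rw [hb1]; exact le_sup_left.trans h')
      · obtain ⟨k, hk, _⟩ := h3 j j
        exact a2v k (by rw [ha2]; exact h'.trans (Vle hk))
    have q2 : ¬ a2 ≤ b2 := by
      intro hle
      rw [ha2, hb2] at hle
      rcases hW.inf'_sup' _ _ _ _ hle with ⟨i, _, h'⟩ | ⟨j, _, h'⟩
      · exact ub2 i (by rw [hb2]; exact le_sup_left.trans h')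
      · exact a2v j (by rw [ha2]; exact h'.trans inf_le_left)
    have q3 : ¬ a2 ≤ a1 := by
      intro hle
      obtain ⟨k, _⟩ := exists_pair_ne ι
      have hle := hle.trans (a1U k)
      have e : U k = exS u k := by rw [hU]
      rw [ha2, e] at hle
      rcases hW.inf'_sup' _ _ _ _ hle with ⟨i, _, h'⟩ | ⟨j, _, h'⟩
      · exact VU i k (by rw [e]; exact le_sup_right.trans h')
      · exact a2x j (by rw [ha2]; exact h'.trans (ux' j))
    have h12 : a2 ≤ b1 ⊔ b2 → False := by
      intro hle
      rw [ha2] at hle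
      rcases hW.inf' _ _ _ _ hle with ⟨k, hk, h'⟩ | h' | h'
      · exact hu'' k (le_sup_left.trans h')
      · exact q1 (by rw [ha2]; exact h')
      · exact q2 (by rw [ha2]; exact h')
    rw [ha2] at hle
    rcases hW.inf' _ _ _ _ hle with ⟨k, hk, h'⟩ | h' | h'
    · exact hu' k (le_sup_left.trans h')
    · exact q3 (by rw [ha2]; exact h')
    · exact h12 (by rw [ha2]; exact h')
  have hC : ¬ b1 ≤ a1 ⊔ (a2 ⊔ b2) := by
    intro hle
    obtain ⟨k, l, hkl⟩ := exists_pair_ne ι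
    rcases VW xa1 (xsup xa2 xb2) ((Vb1 k).trans hle) with h' | h'
    · exact VU k k (h'.trans (a1U k))
    · rcases VW xa2 xb2 h' with h' | h'
      · rcases VW (fun i => xu i l) (fun i => xV i l) (h'.trans (a2V l)) with h' | h'
        · exact Vx _ _ (h'.trans (ux' l))
        · exact Vv k (h'.trans (Vle hkl))
      · rw [hb2] at h' xb2
        obtain ⟨j, _, hj⟩ := VWS xb2 h'
        exact VU _ _ (hj.trans inf_le_right)
  have hD : ¬ b2 ≤ a1 ⊔ (a2 ⊔ b1) := by
    intro hle
    obtain ⟨k, l, hkl⟩ := exists_pair_ne ι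
    have hu'' := usup xa2 xb1 ua2 ub1
    have hu' := usup xa1 (xsup xa2 xb1) ua1 hu''
    rcases hW _ _ _ _ ((Ub2 k).trans hle) with h' | h' | h' | h'
    · exact xsup xa1 (xsup xa2 xb1) k ((xv' k).trans h')
    · exact Usup hu' k h'
    · have hle := h'.trans (a1U l)
      have e : U l = exS u l := by rw [hU]
      rw [e] at hle
      rcases hW.sup' _ _ _ _ hle with h' | h' | ⟨j, _, h'⟩
      · exact xU k l (by rw [e]; exact (xv' k).trans h')
      · exact uU l ((Uge hkl.symm).trans (by rw [e]; exact h'))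
      · exact vUx _ _ _ (h'.trans (ux' j))
    · rcases hW _ _ _ _ h' with h' | h' | h' | h'
      · exact xsup xa2 xb1 k ((xv' k).trans h')
      · exact Usup hu'' k h'
      · rcases hW _ _ _ _ (h'.trans (a2V l)) with h' | h' | h' | h'
        · exact xuV _ _ _ ((xv' k).trans h')
        · obtain ⟨j, hj1, hj2⟩ := h3 k l
          exact uuV hj2 ((Uge hj1).trans h')
        · exact vUx _ _ _ (h'.trans (ux' l))
        · exact wV _ _ h'
      · rw [hb1] at h'
        rcases hW.sup' _ _ _ _ h' with h' | h' | ⟨j, _, h'⟩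
        · exact xb1 k (by rw [hb1]; exact (xv' k).trans h')
        · exact Usup ub1 k (by rw [hb1]; exact h')
        · exact wV _ _ h'
  -- duality
  have dX : ∀ i, dBar δ (X i) = M i := by
    intro i
    rw [hX, hM, exS, anti_sup' (dBar δ) (dBar_sup δ)]
    simp only [hδ]; rfl
  have dM : ∀ i, dBar δ (M i) = X i := by
    intro i
    rw [hX, hM, exI, anti_inf' (dBar δ) (dBar_inf δ)]
    simp only [hδ]; rfl
  have du : ∀ i, dBar δ (u i) = v i := by
    intro i
    rw [hu, hv]
    simp only [dBar_inf, hδ, dX]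
  have dv : ∀ i, dBar δ (v i) = u i := by
    intro i
    rw [hu, hv]
    simp only [dBar_sup, hδ, dM]
  have dU : ∀ i, dBar δ (U i) = V i := by
    intro i
    rw [hU, hV, exS, anti_sup' (dBar δ) (dBar_sup δ)]
    simp only [du]; rfl
  have dV : ∀ i, dBar δ (V i) = U i := by
    intro i
    rw [hU, hV, exI, anti_inf' (dBar δ) (dBar_inf δ)]
    simp only [dv]; rfl
  have da1 : dBar δ a1 = b1 := by
    rw [ha1, hb1, bigI, anti_inf' (dBar δ) (dBar_inf δ)]
    simp only [dU]; rfl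
  have da2 : dBar δ a2 = b2 := by
    rw [ha2, hb2, bigI, anti_inf' (dBar δ) (dBar_inf δ)]
    simp only [dBar_sup, du, dV]; rfl
  have db1 : dBar δ b1 = a1 := by rw [← da1, dBar_dBar δ h hδ]
  have db2 : dBar δ b2 = a2 := by rw [← da2, dBar_dBar δ h hδ]
  -- symmetry
  have hsym : ∀ π : F ≃o F, π a1 = a1 ∧ π b1 = b1 ∧ π a2 = a2 ∧ π b2 = b2 := by
    intro π
    obtain ⟨σ, hσ⟩ := h.exists_perm π
    have pX : ∀ i, π (X i) = X (σ i) := by rw [hX]; exact exS_perm π σ x hσ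
    have pM : ∀ i, π (M i) = M (σ i) := by rw [hM]; exact exI_perm π σ x hσ
    have pu : ∀ i, π (u i) = u (σ i) := by intro i; rw [hu]; simp [hσ, pX]
    have pv : ∀ i, π (v i) = v (σ i) := by intro i; rw [hv]; simp [hσ, pM]
    have pU : ∀ i, π (U i) = U (σ i) := by rw [hU]; exact exS_perm π σ u pu
    have pV : ∀ i, π (V i) = V (σ i) := by rw [hV]; exact exI_perm π σ v pv
    refine ⟨?_, ?_, ?_, ?_⟩
    · rw [ha1]; exact bigI_perm π σ _ pU
    · rw [hb1]; exact bigS_perm π σ _ pV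
    · rw [ha2]; exact bigI_perm π σ _ (fun i => by simp [pu, pV])
    · rw [hb2]; exact bigS_perm π σ _ (fun i => by simp [pv, pU])
  refine ⟨fun a => match a with
    | (false, false) => a1
    | (false, true) => b1
    | (true, false) => a2
    | (true, true) => b2, ?_, ?_, ?_⟩
  · rintro ⟨i, j⟩
    cases i <;> cases j
    · refine ⟨_, ?_, hA⟩
      rintro ⟨i, j⟩ hk
      cases i <;> cases j
      · exact absurd rfl hk
      · exact le_sup_of_le_right le_sup_left
      · exact le_sup_left
      · exact le_sup_of_le_right le_sup_right
    · refine ⟨_, ?_, hC⟩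
      rintro ⟨i, j⟩ hk
      cases i <;> cases j
      · exact le_sup_left
      · exact absurd rfl hk
      · exact le_sup_of_le_right le_sup_left
      · exact le_sup_of_le_right le_sup_right
    · refine ⟨_, ?_, hB⟩
      rintro ⟨i, j⟩ hk
      cases i <;> cases j
      · exact le_sup_left
      · exact le_sup_of_le_right le_sup_left
      · exact absurd rfl hk
      · exact le_sup_of_le_right le_sup_right
    · refine ⟨_, ?_, hD⟩
      rintro ⟨i, j⟩ hk
      cases i <;> cases j
      · exact le_sup_left
      · exact le_sup_of_le_right le_sup_right
      · exact le_sup_of_le_right le_sup_left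
      · exact absurd rfl hk
  · rintro ⟨i, j⟩
    cases i <;> cases j
    · exact da1
    · exact db1
    · exact da2
    · exact db2
  · rintro ⟨i, j⟩ π
    cases i <;> cases j
    · exact (hsym π).1
    · exact (hsym π).2.1
    · exact (hsym π).2.2.1
    · exact (hsym π).2.2.2

end four


section final

theorem tm_countable {α : Type*} [Countable α] : Countable (Tm α) := by
  let L : ℕ → Set (Tm α) := fun n => Nat.rec (Set.range Tm.var)
    (fun _ S => S ∪ (Set.image2 Tm.sup S S ∪ Set.image2 Tm.inf S S)) n
  have hc : ∀ n, (L n).Countable := by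
    intro n
    induction n with
    | zero => exact Set.countable_range _
    | succ n ih => exact ih.union ((ih.image2 ih _).union (ih.image2 ih _))
  have hmono : Monotone L := monotone_nat_of_le_succ fun n => Set.subset_union_left
  have hall : ∀ t : Tm α, ∃ n, t ∈ L n := by
    intro t
    induction t with
    | var a => exact ⟨0, a, rfl⟩
    | sup a b ha hb =>
      obtain ⟨m, hm⟩ := ha
      obtain ⟨n, hn⟩ := hb
      exact ⟨max m n + 1, Or.inr (Or.inl ⟨a, hmono (le_max_left m n) hm, b,
        hmono (le_max_right m n) hn, rfl⟩)⟩
    | inf a b ha hb =>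
      obtain ⟨m, hm⟩ := ha
      obtain ⟨n, hn⟩ := hb
      exact ⟨max m n + 1, Or.inr (Or.inr ⟨a, hmono (le_max_left m n) hm, b,
        hmono (le_max_right m n) hn, rfl⟩)⟩
  rw [← Set.countable_univ_iff]
  exact (Set.countable_iUnion hc).mono fun t _ => Set.mem_iUnion.2 (hall t)

theorem symm_eval {J F : Type*} [Lattice F] {z : J → F} (hz : ∀ a, IsSymmElem (z a)) (t : Tm J) :
    IsSymmElem (Tm.eval z t) := by
  intro π
  rw [Tm.map_eval π (map_sup π) (map_inf π)]
  congr 1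
  funext a
  exact hz a π

theorem exists_family {ι F : Type*} [Lattice F] [Fintype ι] [DecidableEq ι] [Nontrivial ι]
    {x : ι → F} (h : FreeRep x) (h3 : ∀ i j : ι, ∃ k, k ≠ i ∧ k ≠ j)
    (δ : F ≃o Fᵒᵈ) (hδ : ∀ i, dBar δ (x i) = x i) :
    ∃ w : ℕ × Bool → F, Up w ∧ Dn w ∧ (∀ n b, dBar δ (w (n, b)) = w (n, !b)) ∧
      ∀ p, IsSymmElem (w p) := by
  obtain ⟨z, zu, zd, zs⟩ := exists_sym4 h h3 δ hδ
  have zdn : Dn z := zu.dn (dBar δ) (fun a b hab => dBar_anti δ hab) (dBar_dBar δ h hδ) sw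
    (by simp [sw]) zd
  obtain ⟨Θ, hΘ⟩ := (FL.freeRep (Bool × Bool)).exists_lift z
  have hΘ' : ∀ t, Θ (FL.mk t) = Tm.eval z t := fun t => by rw [← FL.eval_of, hΘ]
  have hr : ∀ a b, Θ a ≤ Θ b → a ≤ b := by
    intro a b hab
    obtain ⟨s, rfl⟩ := FL.mk_surj a
    obtain ⟨t, rfl⟩ := FL.mk_surj b
    rw [hΘ', hΘ'] at hab
    exact FL.mk_le.2 (le_of_indep h.whit zu zdn s t hab)
  have hm : ∀ a b, a ≤ b → Θ a ≤ Θ b := fun a b hab => OrderHomClass.mono Θ hab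
  obtain ⟨c, cu, D, hD, hDc, cd⟩ := exists_family4
  refine ⟨fun p => Θ (c p), ?_, ?_, ?_, ?_⟩
  · intro j
    obtain ⟨s, h1, h2⟩ := cu j
    exact ⟨Θ s, fun k hk => hm _ _ (h1 k hk), fun h => h2 (hr _ _ h)⟩
  · intro j
    obtain ⟨s, h1, h2⟩ := cd j
    exact ⟨Θ s, fun k hk => hm _ _ (h1 k hk), fun h => h2 (hr _ _ h)⟩
  · intro n b
    show dBar δ (Θ (c (n, b))) = Θ (c (n, !b))
    rw [← hDc]
    obtain ⟨t, ht⟩ := FL.mk_surj (c (n, b))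
    rw [← ht, hD, hΘ', hΘ', Tm.anti_eval (dBar δ) (dBar_sup δ) (dBar_inf δ), Tm.eval_map]
    congr 1
    funext a
    exact zd a
  · intro p
    obtain ⟨t, ht⟩ := FL.mk_surj (c p)
    show IsSymmElem (Θ (c p))
    rw [← ht, hΘ']
    exact symm_eval zs t

theorem backward {ι F ρ G : Type*} [Lattice F] [Lattice G] [Fintype ι] [DecidableEq ι]
    [Nontrivial ι] {x : ι → F} {y : ρ → G} (h : FreeRep x) (hy : FreeRep y)
    (h3 : ∀ i j : ι, ∃ k, k ≠ i ∧ k ≠ j)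
    (δ : F ≃o Fᵒᵈ) (hδ : ∀ i, dBar δ (x i) = x i)
    (e : ρ → ℕ × Bool) (he : Function.Injective e) (τ : ρ → ρ)
    (hτ : ∀ r, e (τ r) = ((e r).1, !(e r).2)) :
    ∃ φ : LatticeHom G F, IsTotallySymmetricEmbedding δ φ := by
  obtain ⟨w, wu, wd, wD, ws⟩ := exists_family h h3 δ hδ
  have vu : Up (fun r => w (e r)) := fun j => by
    obtain ⟨s, h1, h2⟩ := wu (e j)
    exact ⟨s, fun k hk => h1 _ (fun h => hk (he h)), h2⟩
  have vd : Dn (fun r => w (e r)) := fun j => by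
    obtain ⟨s, h1, h2⟩ := wd (e j)
    exact ⟨s, fun k hk => h1 _ (fun h => hk (he h)), h2⟩
  obtain ⟨φ, hφ⟩ := hy.exists_lift (fun r => w (e r))
  have hmem : ∀ g, ∃ g', φ g' = dBar δ (φ g) := by
    intro g
    obtain ⟨t, rfl⟩ := hy.surj g
    refine ⟨Tm.eval y (t.dual.map τ), ?_⟩
    rw [hφ, hφ, Tm.anti_eval (dBar δ) (dBar_sup δ) (dBar_inf δ), Tm.eval_map]
    congr 1
    funext r
    simp only [Function.comp, hτ]
    exact (wD _ _).symm
  have hr : ∀ a b, φ a ≤ φ b → a ≤ b := by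
    intro a b hab
    obtain ⟨s, rfl⟩ := hy.surj a
    obtain ⟨t, rfl⟩ := hy.surj b
    rw [hφ, hφ] at hab
    exact (hy.le_iff _ _).2 (le_of_indep h.whit vu vd s t hab)
  refine ⟨φ, fun a b hab => le_antisymm (hr _ _ hab.le) (hr _ _ hab.ge), ?_, ?_⟩
  · apply Set.Subset.antisymm
    · rintro _ ⟨_, ⟨g, rfl⟩, rfl⟩
      exact hmem g
    · rintro _ ⟨g, rfl⟩
      exact ⟨dBar δ (φ g), hmem g, dBar_dBar δ h hδ _⟩
  · rintro _ ⟨g, rfl⟩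
    obtain ⟨t, rfl⟩ := hy.surj g
    rw [hφ]
    exact symm_eval (fun r => ws (e r)) t

theorem even_of_invol {ρ : Type*} [Fintype ρ] (τ : ρ → ρ) (h1 : ∀ r, τ (τ r) = r)
    (h2 : ∀ r, τ r ≠ r) : Even (Fintype.card ρ) := by
  classical
  by_contra hne
  have : Fact (Nat.Prime 2) := ⟨Nat.prime_two⟩
  obtain ⟨a, ha⟩ := Equiv.Perm.exists_fixed_point_of_prime (α := ρ) (p := 2) (n := 1)
    (fun hd => hne (even_iff_two_dvd.2 hd)) (σ := ⟨τ, τ, h1, h1⟩) (by ext r; simp [pow_two, h1])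
  exact h2 a ha

end final
end TSE
theorem totally_symmetric_embedding_iff {κ lam : Cardinal.{u}} (hκ : 3 ≤ κ) (hlam : 3 ≤ lam)
    {F : Type*} [Lattice F] {ι : Type u} (x : ι → F) (hx : IsFreelyGenerated x)
    (hι : #ι = lam)
    {G : Type*} [Lattice G] {ρ : Type u} (y : ρ → G) (hy : IsFreelyGenerated y)
    (hρ : #ρ = κ)
    (δ : F ≃o Fᵒᵈ) (hδ : ∀ i, dBar δ (x i) = x i) :
    (∃ φ : LatticeHom G F, IsTotallySymmetricEmbedding δ φ) ↔
      lam < ℵ₀ ∧ (κ = ℵ₀ ∨ ∃ k : ℕ, 0 < k ∧ κ = 2 * (k : Cardinal)) := by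
  have h : TSE.FreeRep x := TSE.freeRep_of_free hx
  have hy' : TSE.FreeRep y := TSE.freeRep_of_free hy
  subst hι hρ
  obtain ⟨e3⟩ : Nonempty (ULift.{u} (Fin 3) ↪ ι) := by
    rw [← Cardinal.le_def]; simpa using hlam
  obtain ⟨r3⟩ : Nonempty (ULift.{u} (Fin 3) ↪ ρ) := by
    rw [← Cardinal.le_def]; simpa using hκ
  have hnt : Nontrivial ι := ⟨e3 ⟨0⟩, e3 ⟨1⟩, fun hh => by simpa using e3.injective hh⟩
  constructor
  · rintro ⟨φ, hinj, hself, hsym⟩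
    have hfin : Finite ι := by
      by_contra hinf
      rw [not_finite_iff_infinite] at hinf
      exact TSE.not_symm_of_infinite h _ (hsym _ ⟨y (r3 ⟨0⟩), rfl⟩)
    refine ⟨Cardinal.lt_aleph0_of_finite ι, ?_⟩
    have hTc : Countable (TSE.Tm ι) := TSE.tm_countable
    have hFc : Countable F :=
      Function.Surjective.countable (f := fun t : TSE.Tm ι => t.eval x) h.surj
    have hρc : Countable ρ :=
      Function.Injective.countable (f := fun r => φ (y r)) (hinj.comp hy'.inj)
    rcases (Cardinal.mk_le_aleph0 (α := ρ)).lt_or_eq with hlt | heq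
    · right
      have : Finite ρ := Cardinal.lt_aleph0_iff_finite.1 hlt
      have := Fintype.ofFinite ρ
      obtain ⟨τ, h1, h2⟩ := TSE.forward_involution h hy' δ hδ φ hinj hself
      have hev := TSE.even_of_invol τ h1 (fun r hr =>
        TSE.not_symm_selfdual h δ hδ (φ (y r)) (hsym _ ⟨_, rfl⟩) (by rw [h2, hr]))
      obtain ⟨k, hk⟩ := hev.two_dvd
      have hpos : 0 < Fintype.card ρ := Fintype.card_pos_iff.2 ⟨r3 ⟨0⟩⟩
      refine ⟨k, by omega, ?_⟩
      rw [Cardinal.mk_fintype, hk]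
      push_cast
      rfl
    · exact Or.inl heq
  · rintro ⟨hlt, hk⟩
    classical
    have : Finite ι := Cardinal.lt_aleph0_iff_finite.1 hlt
    have := Fintype.ofFinite ι
    have h3 : ∀ i j : ι, ∃ k, k ≠ i ∧ k ≠ j := by
      intro i j
      by_contra hcon
      push Not at hcon
      have h01 : e3 ⟨0⟩ ≠ e3 ⟨1⟩ := fun hh => by simpa using e3.injective hh
      have h02 : e3 ⟨0⟩ ≠ e3 ⟨2⟩ := fun hh => by simpa using e3.injective hh
      have h12 : e3 ⟨1⟩ ≠ e3 ⟨2⟩ := fun hh => by simpa using e3.injective hh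
      have a0 := hcon (e3 ⟨0⟩)
      have a1 := hcon (e3 ⟨1⟩)
      have a2 := hcon (e3 ⟨2⟩)
      by_cases b0 : e3 ⟨0⟩ = i <;> by_cases b1 : e3 ⟨1⟩ = i <;> by_cases b2 : e3 ⟨2⟩ = i
      · exact h01 (b0.trans b1.symm)
      · exact h01 (b0.trans b1.symm)
      · exact h02 (b0.trans b2.symm)
      · exact h12 ((a1 b1).trans (a2 b2).symm)
      · exact h12 (b1.trans b2.symm)
      · exact h02 ((a0 b0).trans (a2 b2).symm)
      · exact h01 ((a0 b0).trans (a1 b1).symm)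
      · exact h01 ((a0 b0).trans (a1 b1).symm)
    rcases hk with hk | ⟨k, -, hk⟩
    · obtain ⟨e⟩ : Nonempty (ρ ≃ ℕ × Bool) := by
        rw [← Cardinal.lift_mk_eq']
        simp [hk]
      exact TSE.backward h hy' h3 δ hδ e e.injective
        (fun r => e.symm ((e r).1, !(e r).2)) (by simp)
    · obtain ⟨e⟩ : Nonempty (ρ ≃ Fin k × Bool) := by
        rw [← Cardinal.lift_mk_eq']
        simp [hk, mul_comm]
      exact TSE.backward h hy' h3 δ hδ (fun r => ((e r).1.val, (e r).2))
        (fun a b hab => e.injective (by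
          simp only [Prod.mk.injEq] at hab
          exact Prod.ext (Fin.ext hab.1) hab.2))
        (fun r => e.symm ((e r).1, !(e r).2)) (by simp)
end

section
/- Let F be a lattice freely generated by a family x : Fin 3 → F and let G be a lattice freely generated by a family y : ℕ → G. Then there exists a totally symmetric embedding of G into F. -/
open Cardinal

universe u

namespace TSE

/-- Lattice terms over a set of variables. -/
inductive Tm_s1 (α : Type) : Type
  | v : α → Tm_s1 α
  | s : Tm_s1 α → Tm_s1 α → Tm_s1 α
  | m : Tm_s1 α → Tm_s1 α → Tm_s1 α

variable {α β γ : Type}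

/-- The Whitman quasiorder on lattice terms, as a cut-free calculus. -/
inductive Le : Tm_s1 α → Tm_s1 α → Prop
  | var (i : α) : Le (.v i) (.v i)
  | supL {a b t : Tm_s1 α} : Le a t → Le b t → Le (.s a b) t
  | infR {s c d : Tm_s1 α} : Le s c → Le s d → Le s (.m c d)
  | supR1 {s c d : Tm_s1 α} : Le s c → Le s (.s c d)
  | supR2 {s c d : Tm_s1 α} : Le s d → Le s (.s c d)
  | infL1 {a b t : Tm_s1 α} : Le a t → Le (.m a b) t
  | infL2 {a b t : Tm_s1 α} : Le b t → Le (.m a b) t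

theorem Le.refl (t : Tm_s1 α) : Le t t := by
  induction t with
  | v i => exact .var i
  | s a b ha hb => exact .supL (.supR1 ha) (.supR2 hb)
  | m a b ha hb => exact .infR (.infL1 ha) (.infL2 hb)

theorem Le.sup_left {a b t : Tm_s1 α} (h : Le (.s a b) t) : Le a t ∧ Le b t := by
  generalize hs : Tm_s1.s a b = s at h
  induction h with
  | var i => cases hs
  | supL h1 h2 _ _ => cases hs; exact ⟨h1, h2⟩
  | infR _ _ ih1 ih2 => exact ⟨.infR (ih1 hs).1 (ih2 hs).1, .infR (ih1 hs).2 (ih2 hs).2⟩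
  | supR1 _ ih => exact ⟨.supR1 (ih hs).1, .supR1 (ih hs).2⟩
  | supR2 _ ih => exact ⟨.supR2 (ih hs).1, .supR2 (ih hs).2⟩
  | infL1 _ _ => cases hs
  | infL2 _ _ => cases hs

theorem Le.inf_right {a b t : Tm_s1 α} (h : Le t (.m a b)) : Le t a ∧ Le t b := by
  generalize hs : Tm_s1.m a b = s at h
  induction h with
  | var i => cases hs
  | infR h1 h2 _ _ => cases hs; exact ⟨h1, h2⟩
  | supL _ _ ih1 ih2 => exact ⟨.supL (ih1 hs).1 (ih2 hs).1, .supL (ih1 hs).2 (ih2 hs).2⟩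
  | infL1 _ ih => exact ⟨.infL1 (ih hs).1, .infL1 (ih hs).2⟩
  | infL2 _ ih => exact ⟨.infL2 (ih hs).1, .infL2 (ih hs).2⟩
  | supR1 _ _ => cases hs
  | supR2 _ _ => cases hs

theorem Le.trans {a b c : Tm_s1 α} (h1 : Le a b) (h2 : Le b c) : Le a c := by
  induction b generalizing a c with
  | v i =>
    generalize hs : Tm_s1.v i = s at h1
    induction h1 with
    | var j => cases hs; exact h2
    | supL _ _ ih1 ih2 => exact .supL (ih1 hs) (ih2 hs)
    | infL1 _ ih => exact .infL1 (ih hs)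
    | infL2 _ ih => exact .infL2 (ih hs)
    | infR _ _ => cases hs
    | supR1 _ _ => cases hs
    | supR2 _ _ => cases hs
  | s p q ihp ihq =>
    obtain ⟨hp, hq⟩ := h2.sup_left
    generalize hs : Tm_s1.s p q = s at h1
    induction h1 with
    | var j => cases hs
    | supL _ _ ih1 ih2 => exact .supL (ih1 hs) (ih2 hs)
    | infL1 _ ih => exact .infL1 (ih hs)
    | infL2 _ ih => exact .infL2 (ih hs)
    | infR _ _ => cases hs
    | supR1 h _ => cases hs; exact ihp h hp
    | supR2 h _ => cases hs; exact ihq h hq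
  | m p q ihp ihq =>
    obtain ⟨hp, hq⟩ := h1.inf_right
    generalize hs : Tm_s1.m p q = s at h2
    induction h2 with
    | var j => cases hs
    | infR _ _ ih1 ih2 => exact .infR (ih1 hs) (ih2 hs)
    | supR1 _ ih => exact .supR1 (ih hs)
    | supR2 _ ih => exact .supR2 (ih hs)
    | supL _ _ => cases hs
    | infL1 h _ => cases hs; exact ihp hp h
    | infL2 h _ => cases hs; exact ihq hq h

theorem le_var_var {i j : α} : Le (.v i) (.v j) ↔ i = j :=
  ⟨fun h => by cases h; rfl, fun h => h ▸ .var _⟩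

theorem le_sup_left {a b t : Tm_s1 α} : Le (.s a b) t ↔ Le a t ∧ Le b t :=
  ⟨Le.sup_left, fun h => .supL h.1 h.2⟩

theorem le_inf_right {a b t : Tm_s1 α} : Le t (.m a b) ↔ Le t a ∧ Le t b :=
  ⟨Le.inf_right, fun h => .infR h.1 h.2⟩

theorem le_var_sup {i : α} {c d : Tm_s1 α} : Le (.v i) (.s c d) ↔ Le (.v i) c ∨ Le (.v i) d :=
  ⟨fun h => by cases h with
    | supR1 h => exact .inl h
    | supR2 h => exact .inr h, fun h => h.elim .supR1 .supR2⟩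

theorem le_inf_var {i : α} {c d : Tm_s1 α} : Le (.m c d) (.v i) ↔ Le c (.v i) ∨ Le d (.v i) :=
  ⟨fun h => by cases h with
    | infL1 h => exact .inl h
    | infL2 h => exact .inr h, fun h => h.elim .infL1 .infL2⟩

/-- The Whitman condition. -/
theorem le_inf_sup {a b c d : Tm_s1 α} : Le (.m a b) (.s c d) ↔
    Le a (.s c d) ∨ Le b (.s c d) ∨ Le (.m a b) c ∨ Le (.m a b) d :=
  ⟨fun h => by cases h with
    | infL1 h => exact .inl h
    | infL2 h => exact .inr (.inl h)
    | supR1 h => exact .inr (.inr (.inl h))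
    | supR2 h => exact .inr (.inr (.inr h)),
   fun h => by
    rcases h with h | h | h | h
    · exact .infL1 h
    · exact .infL2 h
    · exact .supR1 h
    · exact .supR2 h⟩

/-! ### Decision procedure -/

def Tm_s1.sz : Tm_s1 α → ℕ
  | .v _ => 1
  | .s a b => a.sz + b.sz + 1
  | .m a b => a.sz + b.sz + 1

def leB [DecidableEq α] : ℕ → Tm_s1 α → Tm_s1 α → Bool
  | 0, _, _ => false
  | n + 1, .s a b, t => leB n a t && leB n b t
  | n + 1, .v i, .v j => decide (i = j)
  | n + 1, .v i, .s c d => leB n (.v i) c || leB n (.v i) d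
  | n + 1, .v i, .m c d => leB n (.v i) c && leB n (.v i) d
  | n + 1, .m a b, .v j => leB n a (.v j) || leB n b (.v j)
  | n + 1, .m a b, .m c d => leB n (.m a b) c && leB n (.m a b) d
  | n + 1, .m a b, .s c d => leB n a (.s c d) || (leB n b (.s c d) ||
      (leB n (.m a b) c || leB n (.m a b) d))

theorem leB_iff [DecidableEq α] (n : ℕ) (s t : Tm_s1 α) (h : s.sz + t.sz ≤ n) :
    leB n s t = true ↔ Le s t := by
  induction n generalizing s t with
  | zero => cases s <;> simp [Tm_s1.sz] at h
  | succ n ih =>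
    cases s with
    | s a b =>
      simp only [Tm_s1.sz] at h
      rw [leB, Bool.and_eq_true, ih _ _ (by omega), ih _ _ (by omega), le_sup_left]
    | v i =>
      cases t with
      | v j => simp [leB, le_var_var]
      | s c d =>
        simp only [Tm_s1.sz] at h
        rw [leB, Bool.or_eq_true, ih _ _ (by simp only [Tm_s1.sz]; omega),
          ih _ _ (by simp only [Tm_s1.sz]; omega), le_var_sup]
      | m c d =>
        simp only [Tm_s1.sz] at h
        rw [leB, Bool.and_eq_true, ih _ _ (by simp only [Tm_s1.sz]; omega),
          ih _ _ (by simp only [Tm_s1.sz]; omega), le_inf_right]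
    | m a b =>
      cases t with
      | v j =>
        simp only [Tm_s1.sz] at h
        rw [leB, Bool.or_eq_true, ih _ _ (by simp only [Tm_s1.sz]; omega),
          ih _ _ (by simp only [Tm_s1.sz]; omega), le_inf_var]
      | s c d =>
        simp only [Tm_s1.sz] at h
        rw [leB, Bool.or_eq_true, Bool.or_eq_true, Bool.or_eq_true,
          ih _ _ (by simp only [Tm_s1.sz]; omega), ih _ _ (by simp only [Tm_s1.sz]; omega),
          ih _ _ (by simp only [Tm_s1.sz]; omega), ih _ _ (by simp only [Tm_s1.sz]; omega), le_inf_sup]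
      | m c d =>
        simp only [Tm_s1.sz] at h
        rw [leB, Bool.and_eq_true, ih _ _ (by simp only [Tm_s1.sz]; omega),
          ih _ _ (by simp only [Tm_s1.sz]; omega), le_inf_right]

instance [DecidableEq α] (s t : Tm_s1 α) : Decidable (Le s t) :=
  decidable_of_iff _ (leB_iff (s.sz + t.sz) s t le_rfl)

/-! ### Substitution, duality and independence -/

def Tm_s1.sub (f : α → Tm_s1 β) : Tm_s1 α → Tm_s1 β
  | .v i => f i
  | .s a b => .s (a.sub f) (b.sub f)
  | .m a b => .m (a.sub f) (b.sub f)

theorem Tm_s1.sub_sub (f : α → Tm_s1 β) (g : β → Tm_s1 γ) (t : Tm_s1 α) :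
    (t.sub f).sub g = t.sub (fun i => (f i).sub g) := by
  induction t with
  | v i => rfl
  | s a b ha hb => simp only [Tm_s1.sub, ha, hb]
  | m a b ha hb => simp only [Tm_s1.sub, ha, hb]

theorem Le.sub_mono {f g : α → Tm_s1 β} (h : ∀ i, Le (f i) (g i)) (t : Tm_s1 α) :
    Le (t.sub f) (t.sub g) := by
  induction t with
  | v i => exact h i
  | s a b ha hb => exact .supL (.supR1 ha) (.supR2 hb)
  | m a b ha hb => exact .infR (.infL1 ha) (.infL2 hb)

/-- The dual term, with variables renamed by `τ`. -/
def Tm_s1.du (τ : α → α) : Tm_s1 α → Tm_s1 α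
  | .v i => .v (τ i)
  | .s a b => .m (a.du τ) (b.du τ)
  | .m a b => .s (a.du τ) (b.du τ)

theorem Tm_s1.du_du {τ : α → α} (hτ : ∀ i, τ (τ i) = i) (t : Tm_s1 α) : (t.du τ).du τ = t := by
  induction t with
  | v i => simp only [Tm_s1.du, hτ]
  | s a b ha hb => simp only [Tm_s1.du, ha, hb]
  | m a b ha hb => simp only [Tm_s1.du, ha, hb]

theorem Le.du {τ : α → α} {s t : Tm_s1 α} (h : Le s t) : Le (t.du τ) (s.du τ) := by
  induction h with
  | var i => exact .var _
  | supL _ _ h1 h2 => exact .infR h1 h2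
  | infR _ _ h1 h2 => exact .supL h1 h2
  | supR1 _ h => exact .infL1 h
  | supR2 _ h => exact .infL2 h
  | infL1 _ h => exact .supR1 h
  | infL2 _ h => exact .supR2 h

theorem Tm_s1.du_sub {τ : α → α} {ρ : β → β} {f : α → Tm_s1 β} (hf : ∀ i, f (τ i) = (f i).du ρ)
    (t : Tm_s1 α) : (t.du τ).sub f = (t.sub f).du ρ := by
  induction t with
  | v i => exact hf i
  | s a b ha hb => simp only [Tm_s1.du, Tm_s1.sub, ha, hb]
  | m a b ha hb => simp only [Tm_s1.du, Tm_s1.sub, ha, hb]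

/-- Independent families of terms. -/
def Ind (f : α → Tm_s1 β) : Prop := ∀ s t : Tm_s1 α, Le (s.sub f) (t.sub f) → Le s t

theorem Ind.comp {f : α → Tm_s1 β} {g : β → Tm_s1 γ} (hf : Ind f) (hg : Ind g) :
    Ind (fun i => (f i).sub g) := by
  intro s t h
  rw [← Tm_s1.sub_sub, ← Tm_s1.sub_sub] at h
  exact hf _ _ (hg _ _ h)

/-- `f i` is not below joins of other members. -/
def JSep (f : α → Tm_s1 β) (i : α) : Prop := ∃ P : Tm_s1 β → Prop,
  (∀ u w, Le u w → P w → P u) ∧ (∀ u w, P u → P w → P (.s u w)) ∧ (∀ j, j ≠ i → P (f j)) ∧ ¬ P (f i)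

/-- `f i` is not above meets of other members. -/
def MSep (f : α → Tm_s1 β) (i : α) : Prop := ∃ P : Tm_s1 β → Prop,
  (∀ u w, Le w u → P w → P u) ∧ (∀ u w, P u → P w → P (.m u w)) ∧ (∀ j, j ≠ i → P (f j)) ∧ ¬ P (f i)

theorem JSep.le {f : α → Tm_s1 β} {i : α} (h : JSep f i) (t : Tm_s1 α) (ht : Le (f i) (t.sub f)) :
    Le (.v i) t := by
  obtain ⟨P, hP1, hP2, hP3, hP4⟩ := h
  have key : ∀ t : Tm_s1 α, Le (.v i) t ∨ P (t.sub f) := by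
    intro t
    induction t with
    | v j =>
      by_cases hj : j = i
      · exact .inl (hj ▸ .var _)
      · exact .inr (hP3 j hj)
    | s a b ha hb =>
      rcases ha with ha | ha
      · exact .inl (.supR1 ha)
      rcases hb with hb | hb
      · exact .inl (.supR2 hb)
      exact .inr (hP2 _ _ ha hb)
    | m a b ha hb =>
      rcases ha with ha | ha
      · rcases hb with hb | hb
        · exact .inl (.infR ha hb)
        · exact .inr (hP1 _ _ (.infL2 (.refl _)) hb)
      · exact .inr (hP1 _ _ (.infL1 (.refl _)) ha)
  exact (key t).resolve_right fun h => hP4 (hP1 _ _ ht h)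

theorem MSep.le {f : α → Tm_s1 β} {i : α} (h : MSep f i) (t : Tm_s1 α) (ht : Le (t.sub f) (f i)) :
    Le t (.v i) := by
  obtain ⟨P, hP1, hP2, hP3, hP4⟩ := h
  have key : ∀ t : Tm_s1 α, Le t (.v i) ∨ P (t.sub f) := by
    intro t
    induction t with
    | v j =>
      by_cases hj : j = i
      · exact .inl (hj ▸ .var _)
      · exact .inr (hP3 j hj)
    | m a b ha hb =>
      rcases ha with ha | ha
      · exact .inl (.infL1 ha)
      rcases hb with hb | hb
      · exact .inl (.infL2 hb)
      exact .inr (hP2 _ _ ha hb)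
    | s a b ha hb =>
      rcases ha with ha | ha
      · rcases hb with hb | hb
        · exact .inl (.supL ha hb)
        · exact .inr (hP1 _ _ (.supR2 (.refl _)) hb)
      · exact .inr (hP1 _ _ (.supR1 (.refl _)) ha)
  exact (key t).resolve_right fun h => hP4 (hP1 _ _ ht h)

theorem ind_of_sep {f : α → Tm_s1 β} (hJ : ∀ i, JSep f i) (hM : ∀ i, MSep f i) : Ind f := by
  intro s
  induction s with
  | v i => exact fun t h => (hJ i).le t h
  | s a b ha hb => exact fun t h => .supL (ha _ h.sup_left.1) (hb _ h.sup_left.2)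
  | m a b ha hb =>
    intro t
    induction t with
    | v i => exact fun h => (hM i).le _ h
    | m c d hc hd => exact fun h => .infR (hc h.inf_right.1) (hd h.inf_right.2)
    | s c d hc hd =>
      intro h
      rcases le_inf_sup.1 h with h | h | h | h
      · exact .infL1 (ha _ h)
      · exact .infL2 (hb _ h)
      · exact .supR1 (hc h)
      · exact .supR2 (hd h)

theorem JSep.dual {f : α → Tm_s1 β} {τ : α → α} {ρ : β → β} (hτ : ∀ i, τ (τ i) = i)
    (hρ : ∀ i, ρ (ρ i) = i) (hf : ∀ i, f (τ i) = (f i).du ρ) {i : α} (h : JSep f i) :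
    MSep f (τ i) := by
  obtain ⟨P, hP1, hP2, hP3, hP4⟩ := h
  refine ⟨fun u => P (u.du ρ), fun u w h => hP1 _ _ h.du, fun u w => hP2 _ _, ?_, ?_⟩
  · intro j hj
    rw [← hf]
    exact hP3 _ fun h => hj (by rw [← h, hτ])
  · beta_reduce
    rw [← hf, hτ]; exact hP4

theorem MSep.dual {f : α → Tm_s1 β} {τ : α → α} {ρ : β → β} (hτ : ∀ i, τ (τ i) = i)
    (hρ : ∀ i, ρ (ρ i) = i) (hf : ∀ i, f (τ i) = (f i).du ρ) {i : α} (h : MSep f i) :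
    JSep f (τ i) := by
  obtain ⟨P, hP1, hP2, hP3, hP4⟩ := h
  refine ⟨fun u => P (u.du ρ), fun u w h => hP1 _ _ h.du, fun u w => hP2 _ _, ?_, ?_⟩
  · intro j hj
    rw [← hf]
    exact hP3 _ fun h => hj (by rw [← h, hτ])
  · beta_reduce
    rw [← hf, hτ]; exact hP4

theorem JSep.of_bound {f : α → Tm_s1 β} {i : α} (b : Tm_s1 β) (h1 : ∀ j, j ≠ i → Le (f j) b)
    (h2 : ¬ Le (f i) b) : JSep f i :=
  ⟨fun u => Le u b, fun _ _ h h' => h.trans h', fun _ _ h h' => .supL h h', h1, h2⟩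

/-! ### Step 1: six symmetric elements -/

def t3 (op : Tm_s1 (Fin 3) → Tm_s1 (Fin 3) → Tm_s1 (Fin 3))
    (g : Tm_s1 (Fin 3) → Tm_s1 (Fin 3) → Tm_s1 (Fin 3) → Tm_s1 (Fin 3)) : Tm_s1 (Fin 3) :=
  op (op (g (.v 0) (.v 1) (.v 2)) (g (.v 1) (.v 2) (.v 0))) (g (.v 2) (.v 0) (.v 1))

open Tm_s1 in
def base1 : Fin 3 → Tm_s1 (Fin 3)
  | 0 => t3 m fun x y z => s (m y (s x z)) (m z (s x y))
  | 1 => t3 s fun x y z => m (s x (m y z)) (s (m y (s x z)) (m z (s x y)))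
  | 2 => t3 m fun x y z => s x (m (s (m x z) (m y (s x z))) (s (m x y) (m z (s x y))))

def f1 (p : Fin 3 × Bool) : Tm_s1 (Fin 3) :=
  if p.2 then (base1 p.1).du id else base1 p.1

/-- Join of the members of a list, with a default. -/
def joinL (d : Tm_s1 β) : List (Tm_s1 β) → Tm_s1 β
  | [] => d
  | [a] => a
  | a :: b :: l => .s a (joinL d (b :: l))

def oth1 (i : Fin 3 × Bool) : Tm_s1 (Fin 3) :=
  joinL (.v 0) (([(0, false), (1, false), (2, false), (0, true), (1, true), (2, true)].filter
    (fun j => j ≠ i)).map f1)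

theorem le_joinL (d a : Tm_s1 β) (l : List (Tm_s1 β)) (h : a ∈ l) : Le a (joinL d l) := by
  induction l with
  | nil => cases h
  | cons b l ih =>
    cases l with
    | nil => simp at h; subst h; exact .refl _
    | cons c l =>
      rcases List.mem_cons.1 h with h | h
      · subst h; exact .supR1 (.refl _)
      · exact .supR2 (ih h)

theorem f1_not_le : ∀ i, ¬ Le (f1 i) (oth1 i) := by decide +kernel

theorem f1_ind : Ind f1 := by
  have hJ : ∀ i, JSep f1 i := by
    intro i
    refine JSep.of_bound (oth1 i) ?_ (f1_not_le i)
    intro j hj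
    apply le_joinL
    apply List.mem_map_of_mem
    rw [List.mem_filter]
    refine ⟨?_, by simpa using hj⟩
    exact (by decide : ∀ j : Fin 3 × Bool, j ∈
      [(0, false), (1, false), (2, false), (0, true), (1, true), (2, true)]) j
  refine ind_of_sep hJ fun i => ?_
  have := (hJ (i.1, !i.2)).dual (τ := fun p => (p.1, !p.2)) (ρ := id) (by simp) (by simp) ?_
  · simpa using this
  · rintro ⟨i, _ | _⟩ <;> simp [f1, Tm_s1.du_du]

theorem f1_symm : ∀ p q r : Fin 3, p ≠ q → p ≠ r → q ≠ r → ∀ i,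
    Le ((f1 i).sub ![.v p, .v q, .v r]) (f1 i) := by decide +kernel

/-! ### Step 2: seven elements of the free lattice on three generators, doubled -/

open Tm_s1 in
def base2 (x y z : Tm_s1 β) : Fin 7 → Tm_s1 β
  | 0 => m z (s x (m y (s x z)))
  | 1 => s x (m y (s z (m x (s y z))))
  | 2 => m (s z (m x y)) (s y (m x (s z (m x y))))
  | 3 => s x (m y (s x (m z (s x y))))
  | 4 => s x (m z (s y (m x (s y (m z (s x y))))))
  | 5 => s x (m y (s z (m y (s x (m y z)))))
  | 6 => s x (m z (s y (m z (s x (m y z)))))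

def fl (p : α × Bool) : α × Bool := (p.1, !p.2)

theorem fl_fl (p : α × Bool) : fl (fl p) = p := by simp [fl]

def f2 (p : Fin 7 × Bool) : Tm_s1 (Fin 3 × Bool) :=
  if p.2 then (base2 (.v (0, false)) (.v (1, false)) (.v (2, false)) p.1).du fl
  else base2 (.v (0, false)) (.v (1, false)) (.v (2, false)) p.1

def all7 : List (Fin 7 × Bool) :=
  [(0, false), (1, false), (2, false), (3, false), (4, false), (5, false), (6, false),
    (0, true), (1, true), (2, true), (3, true), (4, true), (5, true), (6, true)]

def oth2 (i : Fin 7 × Bool) : Tm_s1 (Fin 3 × Bool) :=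
  joinL (.v (0, false)) ((all7.filter (fun j => j ≠ i)).map f2)

theorem f2_not_le : ∀ i, ¬ Le (f2 i) (oth2 i) := by decide +kernel

theorem f2_du (i : Fin 7 × Bool) : f2 (fl i) = (f2 i).du fl := by
  rcases i with ⟨i, _ | _⟩
  · simp [f2, fl]
  · simp [f2, fl, Tm_s1.du_du]

theorem f2_ind : Ind f2 := by
  have hJ : ∀ i, JSep f2 i := by
    intro i
    refine JSep.of_bound (oth2 i) ?_ (f2_not_le i)
    intro j hj
    apply le_joinL
    apply List.mem_map_of_mem
    rw [List.mem_filter]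
    refine ⟨?_, by simpa using hj⟩
    exact (by decide : ∀ j : Fin 7 × Bool, j ∈ all7) j
  refine ind_of_sep hJ fun i => ?_
  have := (hJ (fl i)).dual (τ := fl) (ρ := fl) fl_fl fl_fl f2_du
  rwa [fl_fl] at this

/-! ### Step 3: infinitely many -/

theorem Le.sub {s t : Tm_s1 α} (h : Le s t) (f : α → Tm_s1 β) : Le (s.sub f) (t.sub f) := by
  induction h with
  | var i => exact .refl _
  | supL _ _ h1 h2 => exact .supL h1 h2
  | infR _ _ h1 h2 => exact .infR h1 h2
  | supR1 _ h => exact .supR1 h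
  | supR2 _ h => exact .supR2 h
  | infL1 _ h => exact .infL1 h
  | infL2 _ h => exact .infL2 h

def Tm_s1.val (h : α → Bool) : Tm_s1 α → Bool
  | .v i => h i
  | .s a b => a.val h || b.val h
  | .m a b => a.val h && b.val h

theorem Le.val {s t : Tm_s1 α} (hl : Le s t) (h : α → Bool) (hs : s.val h = true) :
    t.val h = true := by
  induction hl <;> simp_all [Tm_s1.val] <;> tauto

theorem Tm_s1.val_du (h : α → Bool) (τ : α → α) (t : Tm_s1 α) :
    (t.du τ).val h = !(t.val fun i => !h (τ i)) := by
  induction t <;> simp_all [Tm_s1.val, Tm_s1.du]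

/-- Ascending chain. -/
def ch (x y z : Tm_s1 α) : ℕ → Tm_s1 α
  | 0 => x
  | n + 1 => .s x (.m y (.s z (.m x (.s y (.m z (ch x y z n))))))

/-- Descending chain. -/
def dch (x y z : Tm_s1 α) : ℕ → Tm_s1 α
  | 0 => x
  | n + 1 => .m x (.s y (.m z (.s x (.m y (.s z (dch x y z n))))))

theorem ch_sub (f : α → Tm_s1 β) (x y z : Tm_s1 α) (n : ℕ) :
    (ch x y z n).sub f = ch (x.sub f) (y.sub f) (z.sub f) n := by
  induction n with
  | zero => rfl
  | succ n ih => simp only [ch, Tm_s1.sub, ih]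

theorem dch_sub (f : α → Tm_s1 β) (x y z : Tm_s1 α) (n : ℕ) :
    (dch x y z n).sub f = dch (x.sub f) (y.sub f) (z.sub f) n := by
  induction n with
  | zero => rfl
  | succ n ih => simp only [dch, Tm_s1.sub, ih]

theorem dch_du (τ : α → α) (x y z : Tm_s1 α) (n : ℕ) :
    (dch x y z n).du τ = ch (x.du τ) (y.du τ) (z.du τ) n := by
  induction n with
  | zero => rfl
  | succ n ih => simp only [dch, ch, Tm_s1.du, ih]

theorem le_ch (x y z : Tm_s1 α) (n : ℕ) : Le x (ch x y z n) := by
  cases n with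
  | zero => exact .refl _
  | succ n => exact .supR1 (.refl _)

theorem dch_le (x y z : Tm_s1 α) (n : ℕ) : Le (dch x y z n) x := by
  cases n with
  | zero => exact .refl _
  | succ n => exact .infL1 (.refl _)

theorem ch_le (x y z : Tm_s1 α) (n : ℕ) : Le (ch x y z n) (.s x y) := by
  cases n with
  | zero => exact .supR1 (.refl _)
  | succ n => exact .supL (.supR1 (.refl _)) (.supR2 (.infL1 (.refl _)))

theorem le_dch (x y z : Tm_s1 α) (n : ℕ) : Le (.m x y) (dch x y z n) := by
  cases n with
  | zero => exact .infL1 (.refl _)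
  | succ n => exact .infR (.infL1 (.refl _)) (.infL2 (.supR1 (.refl _)))

section chain

variable {p q r : α}

theorem ch_meet (hpq : p ≠ q) (hpr : p ≠ r) (hqr : q ≠ r) (n k : ℕ)
    (h : Le (.m (.v r) (ch (.v p) (.v q) (.v r) n)) (ch (.v p) (.v q) (.v r) k)) :
    Le (ch (.v p) (.v q) (.v r) n) (ch (.v p) (.v q) (.v r) k) := by
  have hp := le_ch (.v p) (.v q) (.v r) n
  have hcq : ¬ Le (ch (.v p) (.v q) (.v r) n) (.v q) := fun h => hpq (le_var_var.1 (hp.trans h))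
  cases k with
  | zero =>
    simp only [ch, le_inf_var, le_var_var] at h ⊢
    exact h.resolve_left hpr.symm
  | succ k =>
    rw [ch, le_inf_sup] at h
    rcases h with h | h | h | h
    · simp [le_var_sup, le_inf_right, le_var_var, hpr.symm, hqr.symm] at h
    · exact h
    · rcases le_inf_var.1 h with h | h
      · exact absurd (le_var_var.1 h).symm hpr
      · exact .supR1 h
    · rcases le_inf_var.1 h.inf_right.1 with h | h
      · exact absurd (le_var_var.1 h).symm hqr
      · exact absurd h hcq

theorem ch_step (hpq : p ≠ q) (hpr : p ≠ r) (hqr : q ≠ r) (n k : ℕ)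

    (h : Le (ch (.v p) (.v q) (.v r) (n + 1)) (ch (.v p) (.v q) (.v r) (k + 1))) :
    Le (ch (.v p) (.v q) (.v r) n) (ch (.v p) (.v q) (.v r) k) := by
  have hm := ch_meet hpq hpr hqr n k
  have hp := le_ch (.v p) (.v q) (.v r) n
  have hcq : ¬ Le (ch (.v p) (.v q) (.v r) n) (.v q) := fun h => hpq (le_var_var.1 (hp.trans h))
  have hcr : ¬ Le (ch (.v p) (.v q) (.v r) n) (.v r) := fun h => hpr (le_var_var.1 (hp.trans h))
  have hrc : ¬ Le (.v r) (ch (.v p) (.v q) (.v r) k) := fun h => by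
    have := h.trans (ch_le _ _ _ _)
    simp [le_var_sup, le_var_var, hpr.symm, hqr.symm] at this
  have hx : ¬ Le (ch (.v p) (.v q) (.v r) n) (.s (.v q) (.m (.v r) (ch (.v p) (.v q) (.v r) k))) :=
    fun h => by
      have := hp.trans h
      simp [le_var_sup, le_var_var, le_inf_right, hpr, hpq] at this
  simp only [ch] at h
  simp only [le_sup_left, le_inf_right, le_var_sup, le_inf_var, le_inf_sup, le_var_var, hpq, hpr,
    hqr, hpq.symm, hpr.symm, hqr.symm, hcq, hcr, hrc, hx, true_and, and_true, false_or, or_false,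
    false_and, and_false, true_or, or_true] at h
  exact hm h

theorem ch_strict (hpq : p ≠ q) (hpr : p ≠ r) (hqr : q ≠ r) (n k : ℕ)
    (h : Le (ch (.v p) (.v q) (.v r) n) (ch (.v p) (.v q) (.v r) k)) :
    n ≤ k := by
  induction n generalizing k with
  | zero => exact Nat.zero_le _
  | succ n ih =>
    cases k with
    | zero =>
      simp [ch, le_sup_left, le_var_var, le_inf_var, hpq.symm, hpr.symm] at h
    | succ k => exact Nat.succ_le_succ (ih k (ch_step hpq hpr hqr n k h))

theorem dch_strict (hpq : p ≠ q) (hpr : p ≠ r) (hqr : q ≠ r) (n k : ℕ)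
    (h : Le (dch (.v p) (.v q) (.v r) n) (dch (.v p) (.v q) (.v r) k)) :
    k ≤ n := by
  have := h.du (τ := id)
  rw [dch_du, dch_du] at this
  exact ch_strict hpq hpr hqr _ _ this

end chain

abbrev V7 (i : Fin 7) : Tm_s1 (Fin 7 × Bool) := .v (i, false)

abbrev cc (n : ℕ) : Tm_s1 (Fin 7 × Bool) := ch (V7 0) (V7 1) (V7 2) n
abbrev dd (n : ℕ) : Tm_s1 (Fin 7 × Bool) := dch (V7 0) (V7 1) (V7 2) n

def tt (n : ℕ) : Tm_s1 (Fin 7 × Bool) := .s (.m (V7 3) (cc n)) (.m (V7 4) (dd n))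
def ww (n : ℕ) : Tm_s1 (Fin 7 × Bool) := .m (V7 5) (.s (V7 6) (tt n))

theorem tt_anti (n k : ℕ) (h : Le (tt n) (.s (V7 6) (tt k))) : n = k := by
  have top : Tm_s1 (Fin 7 × Bool) := .s (V7 0) (V7 1)
  apply le_antisymm
  · have h1 := h.sup_left.1.sub (fun i => match i with
      | (3, false) => .s (V7 0) (V7 1)
      | (4, false) => .m (V7 0) (V7 1)
      | (6, false) => V7 0
      | i => .v i)
    simp only [tt, Tm_s1.sub, ch_sub, dch_sub] at h1
    refine ch_strict (p := ((0 : Fin 7), false)) (q := ((1 : Fin 7), false))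
      (r := ((2 : Fin 7), false)) (by decide) (by decide) (by decide) n k ?_
    refine Le.trans (Le.infR (ch_le _ _ _ _) (.refl _)) (h1.trans ?_)
    refine .supL (le_ch _ _ _ _) (.supL (.infL2 (.refl _)) (.infL1 (.infL1 (le_ch _ _ _ _))))
  · have h1 := h.sup_left.2.sub (fun i => match i with
      | (4, false) => .s (V7 0) (V7 1)
      | (3, false) => .m (V7 0) (V7 1)
      | (6, false) => .m (V7 0) (V7 1)
      | i => .v i)
    simp only [tt, Tm_s1.sub, ch_sub, dch_sub] at h1
    refine dch_strict (p := ((0 : Fin 7), false)) (q := ((1 : Fin 7), false))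
      (r := ((2 : Fin 7), false)) (by decide) (by decide) (by decide) n k ?_
    refine Le.trans (Le.infR (.supR1 (dch_le _ _ _ _)) (.refl _)) (h1.trans ?_)
    exact .supL (le_dch _ _ _ _) (.supL (.infL1 (le_dch _ _ _ _)) (.infL2 (.refl _)))

theorem val_ch_true (h : α → Bool) (x y z : Tm_s1 α) (n : ℕ) (hx : x.val h = true) :
    (ch x y z n).val h = true := (le_ch x y z n).val h hx

theorem val_dch_true (h : α → Bool) (x y z : Tm_s1 α) (n : ℕ) (hx : x.val h = true)
    (hy : y.val h = true) :
    (dch x y z n).val h = true := (le_dch x y z n).val h (by simp [Tm_s1.val, hx, hy])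

theorem val_ww (h : Fin 7 × Bool → Bool) (n : ℕ) : (ww n).val h = (h (5, false) &&
    (h (6, false) || (h (3, false) && (cc n).val h || h (4, false) && (dd n).val h))) := rfl

theorem val_tt (h : Fin 7 × Bool → Bool) (n : ℕ) : (tt n).val h =
    (h (3, false) && (cc n).val h || h (4, false) && (dd n).val h) := rfl

theorem not_a_le (k : ℕ) : ¬ Le (V7 5) (.s (V7 6) (tt k)) := fun h => by
  have := h.val (fun i => decide (i = (5, false))) (by simp [Tm_s1.val])
  simp [Tm_s1.val, val_tt] at this

theorem ww_le (n k : ℕ) (h : Le (ww n) (.s (V7 6) (tt k))) : n = k := by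
  have h' := h
  rw [ww, le_inf_sup] at h
  rcases h with h | h | h | h
  · exact absurd h (not_a_le k)
  · exact tt_anti _ _ h.sup_left.2
  · have := Le.val (s := ww n) h (fun i => decide (i ≠ (6, false)))
      (by rw [val_ww, val_ch_true _ _ _ _ _ (by simp [Tm_s1.val])]; simp)
    simp [Tm_s1.val] at this
  · have := Le.val (s := ww n) h (fun i => decide (i = (5, false) ∨ i = (6, false)))
      (by rw [val_ww]; simp)
    simp [val_tt] at this

def f3 (p : ℕ × Bool) : Tm_s1 (Fin 7 × Bool) := if p.2 then (ww p.1).du fl else ww p.1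

theorem f3_du (i : ℕ × Bool) : f3 (fl i) = (f3 i).du fl := by
  rcases i with ⟨i, _ | _⟩
  · simp [f3, fl]
  · simp only [f3, fl]; simp [Tm_s1.du_du fl_fl]

theorem val_ww_un (n : ℕ) : (ww n).val (fun i => !i.2) = true := by
  rw [val_ww]; simp

theorem val_wd_un (n : ℕ) : ((ww n).du fl).val (fun i => !i.2) = false := by
  rw [Tm_s1.val_du]; simp [fl, val_ww]

theorem val_wd_pr (n : ℕ) (h : Fin 7 × Bool → Bool) (hh : ∀ i, h (i, true) = true) :
    ((ww n).du fl).val h = true := by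
  rw [Tm_s1.val_du, val_ww]; simp [fl, hh]

theorem f3_J (n : ℕ) : JSep f3 (n, false) := by
  refine ⟨fun u => ¬ Le (V7 5) u ∧ ¬ Le (V7 6) u ∧ ¬ Le (ww n) u, ?_, ?_, ?_, ?_⟩
  · exact fun u w h ⟨h1, h2, h3⟩ => ⟨fun k => h1 (k.trans h), fun k => h2 (k.trans h),
      fun k => h3 (k.trans h)⟩
  · rintro u w ⟨h1, h2, h3⟩ ⟨k1, k2, k3⟩
    refine ⟨fun h => (le_var_sup.1 h).elim h1 k1, fun h => (le_var_sup.1 h).elim h2 k2, fun h => ?_⟩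
    rw [ww, le_inf_sup] at h
    rcases h with h | h | h | h
    · exact (le_var_sup.1 h).elim h1 k1
    · exact (le_var_sup.1 h.sup_left.1).elim h2 k2
    · exact h3 h
    · exact k3 h
  · rintro ⟨k, _ | _⟩ hk
    · have hk' : n ≠ k := fun h => hk (by rw [h])
      simp only [f3]
      refine ⟨fun h => not_a_le k h.inf_right.2, fun h => ?_, fun h => hk' (ww_le n k h.inf_right.2)⟩
      have := le_var_var.1 h.inf_right.1
      revert this
      decide
    · simp only [f3, if_true]
      refine ⟨fun h => ?_, fun h => ?_, fun h => ?_⟩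
      · have := h.val (fun i => !i.2) rfl
        rw [val_wd_un] at this; cases this
      · have := h.val (fun i => !i.2) rfl
        rw [val_wd_un] at this; cases this
      · have := h.val (fun i => !i.2) (val_ww_un n)
        rw [val_wd_un] at this; cases this
  · exact fun h => h.2.2 (.refl _)

theorem f3_M (n : ℕ) : MSep f3 (n, false) := by
  let h0 : Fin 7 × Bool → Bool := fun i => i.2 || decide (i.1 = 5 ∨ i.1 = 6)
  refine ⟨fun u => ¬ Le u (.s (V7 6) (tt n)) ∧ u.val h0 = true, ?_, ?_, ?_, ?_⟩
  · exact fun u w h ⟨h1, h2⟩ => ⟨fun k => h1 (h.trans k), h.val _ h2⟩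
  · rintro u w ⟨h1, h2⟩ ⟨k1, k2⟩
    have hv : (Tm_s1.m u w).val h0 = true := by simp [Tm_s1.val, h2, k2]
    refine ⟨fun h => ?_, hv⟩
    rw [le_inf_sup] at h
    rcases h with h | h | h | h
    · exact h1 h
    · exact k1 h
    · exact (le_inf_var.1 h).elim (fun h => h1 (.supR1 h)) (fun h => k1 (.supR1 h))
    · have := h.val h0 hv
      simp [val_tt, h0] at this
  · rintro ⟨k, _ | _⟩ hk
    · refine ⟨fun h => hk (by rw [ww_le k n h]), ?_⟩
      show (ww k).val h0 = true
      rw [val_ww]; simp [h0]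
    · refine ⟨fun h => ?_, val_wd_pr k h0 (by simp [h0])⟩
      have := h.val (fun i => i.2) (val_wd_pr k _ (by simp))
      simp [Tm_s1.val, val_tt] at this
  · exact fun h => h.1 (.infL2 (.refl _))

theorem f3_ind : Ind f3 := by
  refine ind_of_sep ?_ ?_
  · rintro ⟨n, _ | _⟩
    · exact f3_J n
    · exact (f3_M n).dual fl_fl fl_fl f3_du
  · rintro ⟨n, _ | _⟩
    · exact f3_M n
    · exact (f3_J n).dual fl_fl fl_fl f3_du

/-! ### Transfer to freely generated lattices -/

theorem f1_du (i : Fin 3 × Bool) : f1 (fl i) = (f1 i).du id := by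
  revert i
  rintro ⟨i, _ | _⟩ <;> simp [fl, f1, Tm_s1.du_du]

theorem Tm_s1.sub_v (t : Tm_s1 α) : t.sub Tm_s1.v = t := by
  induction t with
  | v i => rfl
  | s a b ha hb => simp [Tm_s1.sub, ha, hb]
  | m a b ha hb => simp [Tm_s1.sub, ha, hb]

theorem ind_equiv (E : α ≃ β) : Ind (fun n => Tm_s1.v (E n)) := by
  intro s t h
  have h2 := Le.sub h (fun n => Tm_s1.v (E.symm n))
  rw [Tm_s1.sub_sub, Tm_s1.sub_sub] at h2
  simpa [Tm_s1.sub, Tm_s1.sub_v] using h2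

/-- An enumeration of the index set of the last family. -/
noncomputable def enum : ℕ ≃ ℕ × Bool :=
  ((Equiv.prodComm ℕ Bool).trans Equiv.boolProdNatEquivNat).symm

/-- The induced involution on the natural numbers. -/
noncomputable def tau (n : ℕ) : ℕ := enum.symm (fl (enum n))

theorem tau_tau (n : ℕ) : tau (tau n) = n := by
  simp [tau, fl_fl]

/-- The intermediate family. -/
noncomputable def g2 (n : ℕ) : Tm_s1 (Fin 3 × Bool) := (f3 (enum n)).sub f2

/-- The final family. -/
noncomputable def fam (n : ℕ) : Tm_s1 (Fin 3) := (g2 n).sub f1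

theorem fam_ind : Ind fam := by
  have h := ((Ind.comp (ind_equiv enum) f3_ind).comp f2_ind).comp f1_ind
  exact h

theorem fam_du (n : ℕ) : fam (tau n) = (fam n).du id := by
  have h : enum (tau n) = fl (enum n) := by simp [tau]
  unfold fam g2
  rw [h, f3_du, Tm_s1.du_sub f2_du, Tm_s1.du_sub f1_du]

/-- Evaluation of terms in a lattice. -/
def ev {L : Type*} [Lattice L] (x : α → L) : Tm_s1 α → L
  | .v i => x i
  | .s a b => ev x a ⊔ ev x b
  | .m a b => ev x a ⊓ ev x b

section ev
variable {L : Type*} [Lattice L]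

theorem ev_le (x : α → L) {s t : Tm_s1 α} (h : Le s t) : ev x s ≤ ev x t := by
  induction h with
  | var i => exact le_rfl
  | supL _ _ h1 h2 => exact sup_le h1 h2
  | infR _ _ h1 h2 => exact le_inf h1 h2
  | supR1 _ h => exact le_sup_of_le_left h
  | supR2 _ h => exact le_sup_of_le_right h
  | infL1 _ h => exact inf_le_of_left_le h
  | infL2 _ h => exact inf_le_of_right_le h

theorem ev_sub (x : β → L) (f : α → Tm_s1 β) (t : Tm_s1 α) :
    ev x (t.sub f) = ev (fun i => ev x (f i)) t := by
  induction t with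
  | v i => rfl
  | s a b ha hb => simp [Tm_s1.sub, ev, ha, hb]
  | m a b ha hb => simp [Tm_s1.sub, ev, ha, hb]

theorem ev_hom {K : Type*} [Lattice K] (φ : LatticeHom L K) (x : α → L) (t : Tm_s1 α) :
    φ (ev x t) = ev (fun i => φ (x i)) t := by
  induction t with
  | v i => rfl
  | s a b ha hb => simp [ev, ha, hb]
  | m a b ha hb => simp [ev, ha, hb]

theorem ev_iso (π : L ≃o L) (x : α → L) (t : Tm_s1 α) :
    π (ev x t) = ev (fun i => π (x i)) t := by
  induction t with
  | v i => rfl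
  | s a b ha hb => simp [ev, ha, hb]
  | m a b ha hb => simp [ev, ha, hb]

theorem ev_dual (δ : L ≃o Lᵒᵈ) (x : α → L) (hδ : ∀ i, dBar δ (x i) = x i) (t : Tm_s1 α) :
    dBar δ (ev x t) = ev x (t.du id) := by
  induction t with
  | v i => exact hδ i
  | s a b ha hb =>
    simp only [Tm_s1.du, ev, ← ha, ← hb, dBar, map_sup]
    rfl
  | m a b ha hb =>
    simp only [Tm_s1.du, ev, ← ha, ← hb, dBar, map_inf]
    rfl

end ev

/-- Equivalence of terms. -/
def tmSetoid (α : Type) : Setoid (Tm_s1 α) where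
  r s t := Le s t ∧ Le t s
  iseqv := ⟨fun t => ⟨Le.refl t, Le.refl t⟩, fun h => ⟨h.2, h.1⟩,
    fun h k => ⟨h.1.trans k.1, k.2.trans h.2⟩⟩

/-- The free lattice as a quotient of terms. -/
def Fr (α : Type) : Type := Quotient (tmSetoid α)

/-- The class of a term. -/
def Fr.mk (t : Tm_s1 α) : Fr α := Quotient.mk (tmSetoid α) t

theorem Fr.ind {p : Fr α → Prop} (h : ∀ t, p (Fr.mk t)) (q : Fr α) : p q :=
  Quotient.ind h q

instance frLattice : Lattice (Fr α) where
  le := Quotient.lift₂ (fun s t => Le s t) (by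
    intro a b c d h k
    exact propext ⟨fun l => (h.2.trans l).trans k.1, fun l => (h.1.trans l).trans k.2⟩)
  le_refl := by
    intro a
    induction a using Fr.ind with | _ a
    exact Le.refl a
  le_trans := by
    intro a b c
    induction a using Fr.ind with | _ a
    induction b using Fr.ind with | _ b
    induction c using Fr.ind with | _ c
    exact Le.trans
  le_antisymm := by
    intro a b
    induction a using Fr.ind with | _ a
    induction b using Fr.ind with | _ b
    exact fun h k => Quotient.sound ⟨h, k⟩
  sup := Quotient.map₂ Tm_s1.s (by
    intro a b h c d k
    exact ⟨.supL (.supR1 h.1) (.supR2 k.1), .supL (.supR1 h.2) (.supR2 k.2)⟩)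
  inf := Quotient.map₂ Tm_s1.m (by
    intro a b h c d k
    exact ⟨.infR (.infL1 h.1) (.infL2 k.1), .infR (.infL1 h.2) (.infL2 k.2)⟩)
  le_sup_left := by
    intro a b
    induction a using Fr.ind with | _ a
    induction b using Fr.ind with | _ b
    exact Le.supR1 (Le.refl a)
  le_sup_right := by
    intro a b
    induction a using Fr.ind with | _ a
    induction b using Fr.ind with | _ b
    exact Le.supR2 (Le.refl b)
  sup_le := by
    intro a b c
    induction a using Fr.ind with | _ a
    induction b using Fr.ind with | _ b
    induction c using Fr.ind with | _ c
    exact Le.supL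
  inf_le_left := by
    intro a b
    induction a using Fr.ind with | _ a
    induction b using Fr.ind with | _ b
    exact Le.infL1 (Le.refl a)
  inf_le_right := by
    intro a b
    induction a using Fr.ind with | _ a
    induction b using Fr.ind with | _ b
    exact Le.infL2 (Le.refl b)
  le_inf := by
    intro a b c
    induction a using Fr.ind with | _ a
    induction b using Fr.ind with | _ b
    induction c using Fr.ind with | _ c
    exact Le.infR

theorem ev_fr (t : Tm_s1 α) :
    ev (fun i => (ULift.up (Fr.mk (Tm_s1.v i)) : ULift (Fr α))) t = ULift.up (Fr.mk t) := by
  induction t with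
  | v i => rfl
  | s a b ha hb => simp only [ev, ha, hb]; rfl
  | m a b ha hb => simp only [ev, ha, hb]; rfl

section free
variable {F : Type*} [Lattice F] {x : α → F}

theorem le_of_ev (hx : IsFreelyGenerated x) {s t : Tm_s1 α} (h : ev x s ≤ ev x t) : Le s t := by
  obtain ⟨φ, hφ⟩ := hx.2 (ULift (Fr α)) (fun i => ULift.up (Fr.mk (Tm_s1.v i)))
  have h2 := OrderHomClass.mono φ h
  rw [ev_hom, ev_hom] at h2
  simp only [hφ, ev_fr] at h2
  exact h2

theorem ev_surj (hx : IsFreelyGenerated x) (a : F) : ∃ t, ev x t = a := by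
  have h : latticeClosure (Set.range x) ⊆ Set.range (ev x) := by
    apply latticeClosure_min
    · rintro _ ⟨i, rfl⟩
      exact ⟨.v i, rfl⟩
    · constructor
      · rintro _ ⟨s, rfl⟩ _ ⟨t, rfl⟩
        exact ⟨.s s t, rfl⟩
      · rintro _ ⟨s, rfl⟩ _ ⟨t, rfl⟩
        exact ⟨.m s t, rfl⟩
  rw [hx.1] at h
  exact h (Set.mem_univ a)

theorem gen_sup (hx : IsFreelyGenerated x) (i : α) (a b : F) (h : x i = a ⊔ b) :
    x i = a ∨ x i = b := by
  obtain ⟨s, rfl⟩ := ev_surj hx a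
  obtain ⟨t, rfl⟩ := ev_surj hx b
  have h1 : Le (.v i) (.s s t) := le_of_ev hx (x := x) h.le
  rcases le_var_sup.1 h1 with h2 | h2
  · exact .inl (le_antisymm (ev_le x h2) (h ▸ _root_.le_sup_left))
  · exact .inr (le_antisymm (ev_le x h2) (h ▸ le_sup_right))

theorem gen_inf (hx : IsFreelyGenerated x) (i : α) (a b : F) (h : x i = a ⊓ b) :
    x i = a ∨ x i = b := by
  obtain ⟨s, rfl⟩ := ev_surj hx a
  obtain ⟨t, rfl⟩ := ev_surj hx b
  have h1 : Le (.m s t) (.v i) := le_of_ev hx (x := x) h.ge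
  rcases le_inf_var.1 h1 with h2 | h2
  · exact .inl (le_antisymm (h ▸ inf_le_left) (ev_le x h2))
  · exact .inr (le_antisymm (h ▸ inf_le_right) (ev_le x h2))

theorem irr_gen (t : Tm_s1 α) (h1 : ∀ a b, ev x t = a ⊔ b → ev x t = a ∨ ev x t = b)
    (h2 : ∀ a b, ev x t = a ⊓ b → ev x t = a ∨ ev x t = b) : ∃ j, ev x t = x j := by
  induction t with
  | v i => exact ⟨i, rfl⟩
  | s a b ha hb =>
    rcases h1 (ev x a) (ev x b) rfl with h | h
    · rw [h] at h1 h2 ⊢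
      exact ha h1 h2
    · rw [h] at h1 h2 ⊢
      exact hb h1 h2
  | m a b ha hb =>
    rcases h2 (ev x a) (ev x b) rfl with h | h
    · rw [h] at h1 h2 ⊢
      exact ha h1 h2
    · rw [h] at h1 h2 ⊢
      exact hb h1 h2

theorem iso_gen (hx : IsFreelyGenerated x) (π : F ≃o F) (i : α) : ∃ j, π (x i) = x j := by
  obtain ⟨t, ht⟩ := ev_surj hx (π (x i))
  rw [← ht]
  have key : ∀ c, ev x t = c ↔ x i = π.symm c := by
    intro c
    rw [ht]
    constructor
    · rintro rfl
      simp
    · intro h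
      simp [h]
  apply irr_gen
  · intro a b h
    rw [key, map_sup] at h
    rw [key, key]
    exact gen_sup hx i _ _ h
  · intro a b h
    rw [key, map_inf] at h
    rw [key, key]
    exact gen_inf hx i _ _ h

theorem gen_inj (hx : IsFreelyGenerated x) : Function.Injective x := by
  intro i j h
  exact le_var_var.1 (le_of_ev hx (x := x) (s := .v i) (t := .v j) h.le)

end free

theorem ev_mono {L : Type*} [Lattice L] {x y : α → L} (h : ∀ i, x i ≤ y i) (t : Tm_s1 α) :
    ev x t ≤ ev y t := by
  induction t with
  | v i => exact h i
  | s a b ha hb => exact sup_le_sup ha hb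
  | m a b ha hb => exact inf_le_inf ha hb

section three
variable {F : Type*} [Lattice F] {x : Fin 3 → F}

theorem iso_le (hx : IsFreelyGenerated x) (π : F ≃o F) (s : Tm_s1 (Fin 3 × Bool)) :
    π (ev x (s.sub f1)) ≤ ev x (s.sub f1) := by
  choose σ hσ using iso_gen hx π
  have hinj : ∀ i j, i ≠ j → σ i ≠ σ j := by
    intro i j hij h
    apply hij
    apply gen_inj hx
    apply π.injective
    rw [hσ, hσ, h]
  have hsx : (fun i => π (x i)) =
      fun i => ev x ((![.v (σ 0), .v (σ 1), .v (σ 2)] : Fin 3 → Tm_s1 (Fin 3)) i) := by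
    funext i
    rw [hσ]
    fin_cases i <;> rfl
  rw [ev_iso, ev_sub, ev_sub]
  apply ev_mono
  intro i
  rw [hsx, ← ev_sub]
  apply ev_le
  exact f1_symm _ _ _ (hinj 0 1 (by decide)) (hinj 0 2 (by decide)) (hinj 1 2 (by decide)) i

theorem symm_f1 (hx : IsFreelyGenerated x) (s : Tm_s1 (Fin 3 × Bool)) :
    IsSymmElem (ev x (s.sub f1)) := by
  intro π
  apply le_antisymm (iso_le hx π s)
  have h := π.monotone (iso_le hx π.symm s)
  simpa using h

end three

theorem exists_hom {G F : Type*} [Lattice G] [Lattice F] {y : α → G}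
    (hy : IsFreelyGenerated y) (z : α → F) :
    ∃ φ : LatticeHom G F, ∀ t, φ (ev y t) = ev z t := by
  choose c hc using ev_surj hy
  have key : ∀ t, ev z (c (ev y t)) = ev z t := fun t =>
    le_antisymm (ev_le z (le_of_ev hy (hc _).le)) (ev_le z (le_of_ev hy (hc _).ge))
  refine ⟨⟨⟨fun g => ev z (c g), ?_⟩, ?_⟩, key⟩
  · intro a b
    have h := key (.s (c a) (c b))
    simp only [ev, hc] at h
    exact h
  · intro a b
    have h := key (.m (c a) (c b))
    simp only [ev, hc] at h
    exact h

theorem main {F : Type*} [Lattice F] (x : Fin 3 → F) (hx : IsFreelyGenerated x)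
    {G : Type*} [Lattice G] (y : ℕ → G) (hy : IsFreelyGenerated y)
    (δ : F ≃o Fᵒᵈ) (hδ : ∀ i, dBar δ (x i) = x i) :
    ∃ φ : LatticeHom G F, IsTotallySymmetricEmbedding δ φ := by
  obtain ⟨φ, hφ⟩ := exists_hom hy (fun n => ev x (fam n))
  have hφ' : ∀ t, φ (ev y t) = ev x (t.sub fam) := fun t => by rw [hφ, ev_sub]
  have hd : ∀ t, dBar δ (φ (ev y t)) = φ (ev y (t.du tau)) := by
    intro t
    rw [hφ', hφ', ev_dual δ x hδ, Tm_s1.du_sub fam_du]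
  refine ⟨φ, ?_, ?_, ?_⟩
  · intro a b h
    obtain ⟨s, rfl⟩ := ev_surj hy a
    obtain ⟨t, rfl⟩ := ev_surj hy b
    rw [hφ', hφ'] at h
    exact le_antisymm (ev_le y (fam_ind _ _ (le_of_ev hx h.le)))
      (ev_le y (fam_ind _ _ (le_of_ev hx h.ge)))
  · apply Set.Subset.antisymm
    · rintro _ ⟨_, ⟨a, rfl⟩, rfl⟩
      obtain ⟨s, rfl⟩ := ev_surj hy a
      exact ⟨_, (hd s).symm⟩
    · rintro _ ⟨a, rfl⟩
      obtain ⟨s, rfl⟩ := ev_surj hy a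
      refine ⟨_, ⟨ev y (s.du tau), rfl⟩, ?_⟩
      rw [hd, Tm_s1.du_du tau_tau]
  · rintro _ ⟨a, rfl⟩
    obtain ⟨s, rfl⟩ := ev_surj hy a
    have h : s.sub fam = (s.sub g2).sub f1 := (Tm_s1.sub_sub _ _ _).symm
    rw [hφ', h]
    exact symm_f1 hx _

end TSE

theorem totally_symmetric_embedding_omega_into_three
    {F : Type*} [Lattice F] (x : Fin 3 → F) (hx : IsFreelyGenerated x)
    {G : Type*} [Lattice G] (y : ℕ → G) (hy : IsFreelyGenerated y)
    (δ : F ≃o Fᵒᵈ) (hδ : ∀ i, dBar δ (x i) = x i) :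
    ∃ φ : LatticeHom G F, IsTotallySymmetricEmbedding δ φ := by
  exact TSE.main x hx y hy δ hδ
end

section
/- Let F be a lattice freely generated by a family x : Fin 3 → F and let G be a lattice freely generated by a family y : Fin 4 → G. Then there exists a totally symmetric embedding of G into F. -/
open Cardinal

universe u

namespace WhitmanFree

/-- Lattice terms in `n` variables. -/
inductive Tm (n : ℕ) : Type
  | gen : Fin n → Tm n
  | sup : Tm n → Tm n → Tm n
  | inf : Tm n → Tm n → Tm n

open Tm

/-- Whitman's cut-free derivation system for the order of the free lattice. -/
inductive W {n : ℕ} : Tm n → Tm n → Prop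
  | gen (i : Fin n) : W (gen i) (gen i)
  | supL {a b c : Tm n} : W a c → W b c → W (sup a b) c
  | supR1 {a b c : Tm n} : W a b → W a (sup b c)
  | supR2 {a b c : Tm n} : W a c → W a (sup b c)
  | infR {a b c : Tm n} : W a b → W a c → W a (inf b c)
  | infL1 {a b c : Tm n} : W a c → W (inf a b) c
  | infL2 {a b c : Tm n} : W b c → W (inf a b) c

variable {n : ℕ}

theorem W.rfl' : ∀ a : Tm n, W a a
  | .gen i => .gen i
  | .sup a b => .supL (.supR1 (W.rfl' a)) (.supR2 (W.rfl' b))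
  | .inf a b => .infR (.infL1 (W.rfl' a)) (.infL2 (W.rfl' b))

theorem W.sup_inv {a b c : Tm n} (h : W (sup a b) c) : W a c ∧ W b c := by
  generalize hs : sup a b = s at h
  induction h with
  | gen i => cases hs
  | supL h1 h2 => cases hs; exact ⟨h1, h2⟩
  | supR1 _ ih => exact ⟨.supR1 (ih hs).1, .supR1 (ih hs).2⟩
  | supR2 _ ih => exact ⟨.supR2 (ih hs).1, .supR2 (ih hs).2⟩
  | infR _ _ ih1 ih2 => exact ⟨.infR (ih1 hs).1 (ih2 hs).1, .infR (ih1 hs).2 (ih2 hs).2⟩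
  | infL1 => cases hs
  | infL2 => cases hs

/-- Syntactic dual of a term. -/
def dual : Tm n → Tm n
  | .gen i => .gen i
  | .sup a b => .inf (dual a) (dual b)
  | .inf a b => .sup (dual a) (dual b)

theorem dual_dual : ∀ a : Tm n, dual (dual a) = a
  | .gen i => rfl
  | .sup a b => by simp [dual, dual_dual a, dual_dual b]
  | .inf a b => by simp [dual, dual_dual a, dual_dual b]

theorem W.dual {a b : Tm n} (h : W a b) : W (dual b) (dual a) := by
  induction h with
  | gen i => exact .gen i
  | supL _ _ ih1 ih2 => exact .infR ih1 ih2
  | supR1 _ ih => exact .infL1 ih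
  | supR2 _ ih => exact .infL2 ih
  | infR _ _ ih1 ih2 => exact .supL ih1 ih2
  | infL1 _ ih => exact .supR1 ih
  | infL2 _ ih => exact .supR2 ih

theorem W.of_dual {a b : Tm n} (h : W (WhitmanFree.dual b) (WhitmanFree.dual a)) : W a b := by
  simpa [dual_dual] using h.dual

theorem W.inf_inv {a b c : Tm n} (h : W a (inf b c)) : W a b ∧ W a c := by
  have h' := h.dual
  simp only [WhitmanFree.dual] at h'
  exact ⟨h'.sup_inv.1.of_dual, h'.sup_inv.2.of_dual⟩

theorem W.trans {b : Tm n} : ∀ {a c : Tm n}, W a b → W b c → W a c := by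
  induction b with
  | gen i =>
    intro a c h1 h2
    generalize hs : Tm.gen i = s at h1
    induction h1 with
    | gen j => cases hs; exact h2
    | supL _ _ ih1 ih2 => exact .supL (ih1 hs) (ih2 hs)
    | infL1 _ ih => exact .infL1 (ih hs)
    | infL2 _ ih => exact .infL2 (ih hs)
    | supR1 => cases hs
    | supR2 => cases hs
    | infR => cases hs
  | sup b1 b2 ihb1 ihb2 =>
    intro a c h1 h2
    obtain ⟨k1, k2⟩ := h2.sup_inv
    generalize hs : Tm.sup b1 b2 = s at h1
    induction h1 with
    | gen j => cases hs
    | supL _ _ ih1 ih2 => exact .supL (ih1 hs) (ih2 hs)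
    | infL1 _ ih => exact .infL1 (ih hs)
    | infL2 _ ih => exact .infL2 (ih hs)
    | supR1 h => cases hs; exact ihb1 h k1
    | supR2 h => cases hs; exact ihb2 h k2
    | infR => cases hs
  | inf b1 b2 ihb1 ihb2 =>
    intro a c h1 h2
    obtain ⟨k1, k2⟩ := h1.inf_inv
    generalize hs : Tm.inf b1 b2 = s at h2
    induction h2 with
    | gen j => cases hs
    | infR _ _ ih1 ih2 => exact .infR (ih1 hs) (ih2 hs)
    | supR1 _ ih => exact .supR1 (ih hs)
    | supR2 _ ih => exact .supR2 (ih hs)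
    | infL1 h => cases hs; exact ihb1 k1 h
    | infL2 h => cases hs; exact ihb2 k2 h
    | supL => cases hs

/-! ### A decision procedure -/

theorem W_sup_iff {a b c : Tm n} : W (sup a b) c ↔ W a c ∧ W b c :=
  ⟨W.sup_inv, fun h => .supL h.1 h.2⟩

theorem W_inf_iff {a b c : Tm n} : W a (inf b c) ↔ W a b ∧ W a c :=
  ⟨W.inf_inv, fun h => .infR h.1 h.2⟩

theorem W_gen_gen {i j : Fin n} : W (gen i) (gen j) ↔ i = j :=
  ⟨fun h => by cases h; rfl, fun h => h ▸ .gen i⟩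

theorem W_gen_sup {i : Fin n} {c d : Tm n} :
    W (gen i) (sup c d) ↔ W (gen i) c ∨ W (gen i) d := by
  constructor
  · intro h
    cases h with
    | supR1 h => exact .inl h
    | supR2 h => exact .inr h
  · rintro (h | h)
    exacts [.supR1 h, .supR2 h]

theorem W_inf_gen {i : Fin n} {a b : Tm n} :
    W (inf a b) (gen i) ↔ W a (gen i) ∨ W b (gen i) := by
  constructor
  · intro h
    cases h with
    | infL1 h => exact .inl h
    | infL2 h => exact .inr h
  · rintro (h | h)
    exacts [.infL1 h, .infL2 h]

/-- Whitman's condition. -/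
theorem W_inf_sup {a b c d : Tm n} :
    W (inf a b) (sup c d) ↔
      (W a (sup c d) ∨ W b (sup c d)) ∨ (W (inf a b) c ∨ W (inf a b) d) := by
  constructor
  · intro h
    cases h with
    | infL1 h => exact .inl (.inl h)
    | infL2 h => exact .inl (.inr h)
    | supR1 h => exact .inr (.inl h)
    | supR2 h => exact .inr (.inr h)
  · rintro ((h | h) | (h | h))
    exacts [.infL1 h, .infL2 h, .supR1 h, .supR2 h]

def genLe (i : Fin n) : Tm n → Bool
  | .gen j => decide (i = j)
  | .sup c d => genLe i c || genLe i d
  | .inf c d => genLe i c && genLe i d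

def infLe (f g : Tm n → Bool) : Tm n → Bool
  | .gen j => f (.gen j) || g (.gen j)
  | .sup c d => (f (.sup c d) || g (.sup c d)) || (infLe f g c || infLe f g d)
  | .inf c d => infLe f g c && infLe f g d

def leB : Tm n → Tm n → Bool
  | .gen i => genLe i
  | .sup a b => fun c => leB a c && leB b c
  | .inf a b => infLe (leB a) (leB b)

theorem leB_iff (a : Tm n) : ∀ b, leB a b = true ↔ W a b := by
  induction a with
  | gen i =>
    intro b
    induction b with
    | gen j => simp [leB, genLe, W_gen_gen]
    | sup c d ihc ihd => simp only [leB] at ihc ihd; simp [leB, genLe, W_gen_sup, ihc, ihd]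
    | inf c d ihc ihd => simp only [leB] at ihc ihd; simp [leB, genLe, W_inf_iff, ihc, ihd]
  | sup a b iha ihb => intro c; simp [leB, W_sup_iff, iha, ihb]
  | inf a b iha ihb =>
    intro c
    induction c with
    | gen j => simp [leB, infLe, W_inf_gen, iha, ihb]
    | sup c d ihc ihd =>
      simp only [leB] at ihc ihd; simp [leB, infLe, W_inf_sup, iha, ihb, ihc, ihd]
    | inf c d ihc ihd =>
      simp only [leB] at ihc ihd; simp [leB, infLe, W_inf_iff, ihc, ihd]

/-! ### Evaluation in lattices -/

/-- Evaluation of a term. -/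
def ev {L : Type*} [Lattice L] (f : Fin n → L) : Tm n → L
  | .gen i => f i
  | .sup a b => ev f a ⊔ ev f b
  | .inf a b => ev f a ⊓ ev f b

theorem W.sound {L : Type*} [Lattice L] (f : Fin n → L) {a b : Tm n} (h : W a b) :
    ev f a ≤ ev f b := by
  induction h with
  | gen i => exact le_rfl
  | supL _ _ ih1 ih2 => exact sup_le ih1 ih2
  | supR1 _ ih => exact ih.trans le_sup_left
  | supR2 _ ih => exact ih.trans le_sup_right
  | infR _ _ ih1 ih2 => exact le_inf ih1 ih2
  | infL1 _ ih => exact inf_le_left.trans ih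
  | infL2 _ ih => exact inf_le_right.trans ih

theorem map_ev {L M : Type*} [Lattice L] [Lattice M] (φ : LatticeHom L M) (f : Fin n → L)
    (t : Tm n) : φ (ev f t) = ev (fun i => φ (f i)) t := by
  induction t with
  | gen i => rfl
  | sup a b iha ihb => simp [ev, iha, ihb]
  | inf a b iha ihb => simp [ev, iha, ihb]

/-- Substitution. -/
def sub {m : ℕ} (u : Fin m → Tm n) : Tm m → Tm n
  | .gen i => u i
  | .sup a b => .sup (sub u a) (sub u b)
  | .inf a b => .inf (sub u a) (sub u b)

theorem ev_sub {m : ℕ} {L : Type*} [Lattice L] (f : Fin n → L) (u : Fin m → Tm n) (t : Tm m) :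
    ev f (sub u t) = ev (fun i => ev f (u i)) t := by
  induction t with
  | gen i => rfl
  | sup a b iha ihb => simp [ev, sub, iha, ihb]
  | inf a b iha ihb => simp [ev, sub, iha, ihb]

/-! ### The concrete free lattice, in an arbitrary universe -/

universe w

/-- A copy of the terms in an arbitrary universe. -/
structure LT (n : ℕ) : Type w where
  tm : ULift.{w} (Tm n)

def lmk (t : Tm n) : LT.{w} n := ⟨⟨t⟩⟩

def ltSetoid (n : ℕ) : Setoid (LT.{w} n) where
  r a b := W a.tm.down b.tm.down ∧ W b.tm.down a.tm.down
  iseqv := ⟨fun _ => ⟨.rfl' _, .rfl' _⟩, fun h => ⟨h.2, h.1⟩,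
    fun h k => ⟨h.1.trans k.1, k.2.trans h.2⟩⟩

def FL (n : ℕ) : Type w := Quotient (ltSetoid.{w} n)

def fmk (t : Tm n) : FL.{w} n := Quotient.mk _ (lmk t)

instance : Lattice (FL.{w} n) where
  le := Quotient.lift₂ (fun a b => W a.tm.down b.tm.down) (by
    intro a b c d h k
    exact propext ⟨fun e => (h.2.trans e).trans k.1, fun e => (h.1.trans e).trans k.2⟩)
  sup := Quotient.map₂ (fun a b => lmk (.sup a.tm.down b.tm.down)) (by
    intro a b h c d k
    exact ⟨.supL (.supR1 h.1) (.supR2 k.1), .supL (.supR1 h.2) (.supR2 k.2)⟩)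
  inf := Quotient.map₂ (fun a b => lmk (.inf a.tm.down b.tm.down)) (by
    intro a b h c d k
    exact ⟨.infR (.infL1 h.1) (.infL2 k.1), .infR (.infL1 h.2) (.infL2 k.2)⟩)
  le_refl := by rintro ⟨a⟩; exact .rfl' _
  le_trans := by rintro ⟨a⟩ ⟨b⟩ ⟨c⟩ h k; exact W.trans h k
  le_antisymm := by rintro ⟨a⟩ ⟨b⟩ h k; exact Quotient.sound ⟨h, k⟩
  le_sup_left := by rintro ⟨a⟩ ⟨b⟩; exact .supR1 (.rfl' _)
  le_sup_right := by rintro ⟨a⟩ ⟨b⟩; exact .supR2 (.rfl' _)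
  sup_le := by rintro ⟨a⟩ ⟨b⟩ ⟨c⟩ h k; exact .supL h k
  inf_le_left := by rintro ⟨a⟩ ⟨b⟩; exact .infL1 (.rfl' _)
  inf_le_right := by rintro ⟨a⟩ ⟨b⟩; exact .infL2 (.rfl' _)
  le_inf := by rintro ⟨a⟩ ⟨b⟩ ⟨c⟩ h k; exact .infR h k

theorem ev_fmk (t : Tm n) : ev (fun i => fmk.{w} (.gen i)) t = fmk t := by
  induction t with
  | gen i => rfl
  | sup a b iha ihb => simp only [ev, iha, ihb]; rfl
  | inf a b iha ihb => simp only [ev, iha, ihb]; rfl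

section Free

variable {F : Type*} [Lattice F] {x : Fin n → F}

theorem ev_le_iff (hx : IsFreelyGenerated x) {a b : Tm n} : ev x a ≤ ev x b ↔ W a b := by
  refine ⟨fun h => ?_, fun h => h.sound x⟩
  obtain ⟨φ, hφ⟩ := hx.2 (FL n) (fun i => fmk (.gen i))
  have h1 : φ (ev x a) ≤ φ (ev x b) := OrderHomClass.mono φ h
  rw [map_ev, map_ev] at h1
  simp only [hφ, ev_fmk] at h1
  exact h1

theorem ev_surj (hx : IsFreelyGenerated x) (g : F) : ∃ t, ev x t = g := by
  have hg : g ∈ latticeClosure (Set.range x) := by rw [hx.1]; trivial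
  have hsub : IsSublattice (Set.range (ev x)) := by
    constructor
    · rintro _ ⟨a, rfl⟩ _ ⟨b, rfl⟩; exact ⟨.sup a b, rfl⟩
    · rintro _ ⟨a, rfl⟩ _ ⟨b, rfl⟩; exact ⟨.inf a b, rfl⟩
  have := latticeClosure_min (s := Set.range x) (t := Set.range (ev x))
    (by rintro _ ⟨i, rfl⟩; exact ⟨.gen i, rfl⟩) hsub hg
  exact this

/-- Generators are join prime. -/
theorem gen_joinPrime (hx : IsFreelyGenerated x) (i : Fin n) (a b : F) (h : x i ≤ a ⊔ b) :
    x i ≤ a ∨ x i ≤ b := by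
  obtain ⟨a, rfl⟩ := ev_surj hx a
  obtain ⟨b, rfl⟩ := ev_surj hx b
  have : ev x (.gen i) ≤ ev x (.sup a b) := h
  rw [ev_le_iff hx, W_gen_sup] at this
  exact this.imp (ev_le_iff hx).2 (ev_le_iff hx).2

theorem gen_meetPrime (hx : IsFreelyGenerated x) (i : Fin n) (a b : F) (h : a ⊓ b ≤ x i) :
    a ≤ x i ∨ b ≤ x i := by
  obtain ⟨a, rfl⟩ := ev_surj hx a
  obtain ⟨b, rfl⟩ := ev_surj hx b
  have : ev x (.inf a b) ≤ ev x (.gen i) := h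
  rw [ev_le_iff hx, W_inf_gen] at this
  exact this.imp (ev_le_iff hx).2 (ev_le_iff hx).2

/-- Doubly prime elements are generators. -/
theorem prime_gen (p : F) (hj : ∀ a b, p ≤ a ⊔ b → p ≤ a ∨ p ≤ b)
    (hm : ∀ a b, a ⊓ b ≤ p → a ≤ p ∨ b ≤ p) (t : Tm n) (h : ev x t = p) : ∃ i, p = x i := by
  induction t with
  | gen i => exact ⟨i, h.symm⟩
  | sup a b iha ihb =>
    simp only [ev] at h
    rcases hj _ _ h.ge with k | k
    · exact iha (le_antisymm (le_sup_left.trans h.le) k)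
    · exact ihb (le_antisymm (le_sup_right.trans h.le) k)
  | inf a b iha ihb =>
    simp only [ev] at h
    rcases hm _ _ h.le with k | k
    · exact iha (le_antisymm k (h.ge.trans inf_le_left))
    · exact ihb (le_antisymm k (h.ge.trans inf_le_right))

theorem aut_gen (hx : IsFreelyGenerated x) (π : F ≃o F) (i : Fin n) : ∃ j, π (x i) = x j := by
  obtain ⟨t, ht⟩ := ev_surj hx (π (x i))
  refine prime_gen _ (fun a b h => ?_) (fun a b h => ?_) t ht
  · rw [← π.le_symm_apply, map_sup] at h
    simpa only [π.le_symm_apply] using gen_joinPrime hx i _ _ h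
  · rw [← π.symm_apply_le, map_inf] at h
    simpa only [π.symm_apply_le] using gen_meetPrime hx i _ _ h

theorem gen_inj (hx : IsFreelyGenerated x) : Function.Injective x := by
  intro i j h
  exact W_gen_gen.1 ((ev_le_iff hx (a := .gen i) (b := .gen j)).1 h.le)

end Free

/-! ### The four elements -/

def X : Tm 3 := .gen 0
def Y : Tm 3 := .gen 1
def Z : Tm 3 := .gen 2

def q (x y z : Tm 3) : Tm 3 := inf x (sup y z)
def r (x y z : Tm 3) : Tm 3 := inf x (sup y (q z x y))

def u1 : Tm 3 :=
  inf (sup (q X Y Z) (q Y X Z)) (inf (sup (q X Y Z) (q Z X Y)) (sup (q Y X Z) (q Z X Y)))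

def u2 : Tm 3 :=
  sup (sup (r X Y Z) (r X Z Y)) (sup (sup (r Y X Z) (r Y Z X)) (sup (r Z X Y) (r Z Y X)))

def u : Fin 4 → Tm 3 := ![u1, dual u1, u2, dual u2]

def sw : Fin 4 → Fin 4 := ![1, 0, 3, 2]

def jn : Fin 4 → Tm 4 :=
  ![sup (gen 1) (sup (gen 2) (gen 3)), sup (gen 0) (sup (gen 2) (gen 3)),
    sup (gen 0) (sup (gen 1) (gen 3)), sup (gen 0) (sup (gen 1) (gen 2))]

theorem dual_u (i : Fin 4) : dual (u i) = u (sw i) := by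
  fin_cases i <;> simp [u, sw, dual_dual]

theorem not_le (i : Fin 4) : ¬ W (u i) (sub u (jn i)) := by
  rw [← leB_iff]
  revert i
  decide +kernel

theorem le_jn (i j : Fin 4) (h : j ≠ i) : W (gen j) (jn i) := by
  rw [← leB_iff]
  revert i j
  decide +kernel

theorem W.sub {m : ℕ} (v : Fin m → Tm n) {a b : Tm m} (h : W a b) :
    W (sub v a) (sub v b) := by
  induction h with
  | gen i => exact .rfl' _
  | supL _ _ ih1 ih2 => exact .supL ih1 ih2
  | supR1 _ ih => exact .supR1 ih
  | supR2 _ ih => exact .supR2 ih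
  | infR _ _ ih1 ih2 => exact .infR ih1 ih2
  | infL1 _ ih => exact .infL1 ih
  | infL2 _ ih => exact .infL2 ih

theorem dichotomy (i : Fin 4) (t : Tm 4) : W (u i) (sub u t) ∨ W (sub u t) (sub u (jn i)) := by
  induction t with
  | gen j =>
    by_cases h : j = i
    · subst h; exact .inl (.rfl' _)
    · exact .inr ((le_jn i j h).sub u)
  | sup a b iha ihb =>
    rcases iha with h | h
    · exact .inl (.supR1 h)
    · rcases ihb with k | k
      · exact .inl (.supR2 k)
      · exact .inr (.supL h k)
  | inf a b iha ihb =>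
    rcases iha with h | h
    · rcases ihb with k | k
      · exact .inl (.infR h k)
      · exact .inr (.infL2 k)
    · exact .inr (.infL1 h)

theorem u_joinPrime (i : Fin 4) (a b : Tm 4) (h : W (u i) (sup (sub u a) (sub u b))) :
    W (u i) (sub u a) ∨ W (u i) (sub u b) := by
  rcases dichotomy i a with k | k
  · exact .inl k
  · rcases dichotomy i b with l | l
    · exact .inr l
    · exact absurd (h.trans (.supL k l)) (not_le i)

theorem sw_sw (i : Fin 4) : sw (sw i) = i := by
  revert i; decide

/-- Dualizing a term and swapping the variables. -/
def dsw : Tm 4 → Tm 4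
  | .gen i => .gen (sw i)
  | .sup a b => .inf (dsw a) (dsw b)
  | .inf a b => .sup (dsw a) (dsw b)

theorem dual_sub (t : Tm 4) : dual (sub u t) = sub u (dsw t) := by
  induction t with
  | gen i => exact dual_u i
  | sup a b iha ihb => simp [sub, dual, dsw, iha, ihb]
  | inf a b iha ihb => simp [sub, dual, dsw, iha, ihb]

theorem u_meetPrime (i : Fin 4) (a b : Tm 4) (h : W (inf (sub u a) (sub u b)) (u i)) :
    W (sub u a) (u i) ∨ W (sub u b) (u i) := by
  have h' := h.dual
  simp only [dual, dual_sub, dual_u] at h'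
  refine (u_joinPrime _ _ _ h').imp (fun k => W.of_dual ?_) (fun k => W.of_dual ?_)
  · rwa [dual_sub, dual_u]
  · rwa [dual_sub, dual_u]

theorem sub_reflect (s : Tm 4) : ∀ t : Tm 4, W (sub u s) (sub u t) → W s t := by
  induction s with
  | gen i =>
    intro t
    induction t with
    | gen j =>
      intro h
      by_cases hij : j = i
      · subst hij; exact .gen _
      · exact absurd (h.trans ((le_jn i j hij).sub u)) (not_le i)
    | sup c d ihc ihd =>
      intro h
      rcases u_joinPrime i c d h with k | k
      · exact .supR1 (ihc k)
      · exact .supR2 (ihd k)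
    | inf c d ihc ihd =>
      intro h
      exact .infR (ihc h.inf_inv.1) (ihd h.inf_inv.2)
  | sup a b iha ihb =>
    intro t h
    exact .supL (iha t h.sup_inv.1) (ihb t h.sup_inv.2)
  | inf a b iha ihb =>
    intro t
    induction t with
    | gen j =>
      intro h
      rcases u_meetPrime j a b h with k | k
      · exact .infL1 (iha _ k)
      · exact .infL2 (ihb _ k)
    | sup c d ihc ihd =>
      intro h
      rcases W_inf_sup.1 h with (k | k) | (k | k)
      · exact .infL1 (iha (.sup c d) k)
      · exact .infL2 (ihb (.sup c d) k)
      · exact .supR1 (ihc k)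
      · exact .supR2 (ihd k)
    | inf c d ihc ihd =>
      intro h
      exact .infR (ihc h.inf_inv.1) (ihd h.inf_inv.2)

/-- The four terms are symmetric. -/
theorem u_symm (τ : Fin 3 → Fin 3) (hτ : Function.Injective τ) (i : Fin 4) :
    W (sub (fun j => gen (τ j)) (u i)) (u i) ∧ W (u i) (sub (fun j => gen (τ j)) (u i)) := by
  rw [← leB_iff, ← leB_iff]
  revert τ i
  decide +kernel

theorem ev_perm {F : Type*} [Lattice F] (x : Fin 3 → F) (τ : Fin 3 → Fin 3)
    (hτ : Function.Injective τ) (i : Fin 4) : ev (fun j => x (τ j)) (u i) = ev x (u i) := by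
  have h := u_symm τ hτ i
  have e := ev_sub x (fun j => gen (τ j)) (u i)
  simp only [ev] at e
  rw [← e]
  exact le_antisymm (h.1.sound x) (h.2.sound x)

theorem dBar_ev {F : Type*} [Lattice F] (x : Fin n → F) (δ : F ≃o Fᵒᵈ)
    (hδ : ∀ i, dBar δ (x i) = x i) (t : Tm n) : dBar δ (ev x t) = ev x (dual t) := by
  induction t with
  | gen i => exact hδ i
  | sup a b iha ihb =>
    simp only [ev, dual, ← iha, ← ihb, dBar, map_sup]; rfl
  | inf a b iha ihb =>
    simp only [ev, dual, ← iha, ← ihb, dBar, map_inf]; rfl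

end WhitmanFree

theorem totally_symmetric_embedding_four_into_three
    {F : Type*} [Lattice F] (x : Fin 3 → F) (hx : IsFreelyGenerated x)
    {G : Type*} [Lattice G] (y : Fin 4 → G) (hy : IsFreelyGenerated y)
    (δ : F ≃o Fᵒᵈ) (hδ : ∀ i, dBar δ (x i) = x i) :
    ∃ φ : LatticeHom G F, IsTotallySymmetricEmbedding δ φ := by
  classical
  choose tm htm using WhitmanFree.ev_surj hy
  let v : Fin 4 → F := fun i => WhitmanFree.ev x (WhitmanFree.u i)
  have hv : ∀ t, WhitmanFree.ev v t = WhitmanFree.ev x (WhitmanFree.sub WhitmanFree.u t) :=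
    fun t => (WhitmanFree.ev_sub x WhitmanFree.u t).symm
  have key : ∀ s t, WhitmanFree.ev v s ≤ WhitmanFree.ev v t ↔
      WhitmanFree.ev y s ≤ WhitmanFree.ev y t := by
    intro s t
    rw [hv, hv, WhitmanFree.ev_le_iff hx, WhitmanFree.ev_le_iff hy]
    exact ⟨WhitmanFree.sub_reflect s t, fun h => h.sub _⟩
  have keq : ∀ s t, WhitmanFree.ev y s = WhitmanFree.ev y t →
      WhitmanFree.ev v s = WhitmanFree.ev v t := fun s t h =>
    le_antisymm ((key s t).2 h.le) ((key t s).2 h.ge)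
  let φ : LatticeHom G F :=
    { toFun := fun g => WhitmanFree.ev v (tm g)
      map_sup' := fun a b => keq _ (.sup (tm a) (tm b)) (by simp only [WhitmanFree.ev, htm])
      map_inf' := fun a b => keq _ (.inf (tm a) (tm b)) (by simp only [WhitmanFree.ev, htm]) }
  have hφ : ∀ g, φ g = WhitmanFree.ev v (tm g) := fun g => rfl
  have hr : Set.range φ = Set.range (WhitmanFree.ev v) := by
    ext w
    constructor
    · rintro ⟨g, rfl⟩; exact ⟨tm g, rfl⟩
    · rintro ⟨t, rfl⟩
      exact ⟨WhitmanFree.ev y t, keq _ _ (htm _)⟩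
  have hd : ∀ t, dBar δ (WhitmanFree.ev v t) = WhitmanFree.ev v (WhitmanFree.dsw t) := by
    intro t
    rw [hv, hv, WhitmanFree.dBar_ev x δ hδ, WhitmanFree.dual_sub]
  have hdd : ∀ w, dBar δ (dBar δ w) = w := by
    intro w
    obtain ⟨t, rfl⟩ := WhitmanFree.ev_surj hx w
    rw [WhitmanFree.dBar_ev x δ hδ, WhitmanFree.dBar_ev x δ hδ, WhitmanFree.dual_dual]
  refine ⟨φ, ?_, ?_, ?_⟩
  · intro a b h
    rw [hφ, hφ] at h
    rw [← htm a, ← htm b]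
    exact le_antisymm ((key _ _).1 h.le) ((key _ _).1 h.ge)
  · unfold SelfduallyPositioned
    rw [hr]
    ext w
    constructor
    · rintro ⟨_, ⟨t, rfl⟩, rfl⟩
      exact ⟨_, (hd t).symm⟩
    · rintro ⟨t, rfl⟩
      exact ⟨_, ⟨_, (hd t).symm⟩, hdd _⟩
  · rw [hr]
    rintro _ ⟨t, rfl⟩ π
    choose τ hτ using WhitmanFree.aut_gen hx π
    have hinj : Function.Injective τ := by
      intro i j h
      apply WhitmanFree.gen_inj hx
      apply π.injective
      rw [hτ, hτ, h]
    let πh : LatticeHom F F := ⟨⟨π, map_sup π⟩, map_inf π⟩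
    have hπ : ∀ w, πh w = π w := fun _ => rfl
    have hfix : ∀ i, πh (v i) = v i := by
      intro i
      have := WhitmanFree.map_ev πh x (WhitmanFree.u i)
      simp only [hπ, hτ] at this
      exact this.trans (WhitmanFree.ev_perm x τ hinj i)
    rw [← hπ, WhitmanFree.map_ev]
    simp only [hfix]
end
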